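/- arXiv:2309.00097 — 8 statements merged into one kernel-verified Lean document; each statement's English description precedes it below -/
import Mathlib

section
/- For every integer n ≥ 2 the Bell numbers satisfy B_{n+1}/B_n ≥ n/(2·log n); equivalently, 2·(log n)·B_{n+1} ≥ n·B_n, where log denotes the natural logarithm. -/
open scoped Classical

/-- A partition of `[n]` (modeled as `Fin n`): a set of pairwise disjoint nonempty
subsets whose union is everything. -/
def IsPartition {n : ℕ} (P : Finset (Finset (Fin n))) : Prop :=
  ∅ ∉ P ∧ (∀ p ∈ P, ∀ q ∈ P, p ≠ q → Disjoint p q) ∧ ∀ x : Fin n, ∃ p ∈ P, x ∈ p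

/-- The `n`-th Bell number: the number of partitions of `[n]`. -/
noncomputable def bell (n : ℕ) : ℕ :=
  (Finset.univ.filter fun P : Finset (Finset (Fin n)) => IsPartition P).card

/-- `P` is a partition of the finite set `s` into nonempty pairwise disjoint parts. -/
def IsPartitionOf {α : Type*} (s : Finset α) (P : Finset (Finset α)) : Prop :=
  ∅ ∉ P ∧ (∀ p ∈ P, ∀ q ∈ P, p ≠ q → Disjoint p q) ∧ ∀ x : α, x ∈ s ↔ ∃ p ∈ P, x ∈ p

/-- The finset of all partitions of `s`. -/
noncomputable def partitionsOf {α : Type*} [Fintype α] (s : Finset α) :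
    Finset (Finset (Finset α)) :=
  Finset.univ.filter (IsPartitionOf s)

theorem mem_partitionsOf {α : Type*} [Fintype α] {s : Finset α} {P : Finset (Finset α)} :
    P ∈ partitionsOf s ↔ IsPartitionOf s P := by
  simp [partitionsOf]

theorem partitionsOf_empty {α : Type*} [Fintype α] :
    partitionsOf (∅ : Finset α) = {∅} := by
  ext P
  rw [mem_partitionsOf, Finset.mem_singleton]
  constructor
  · rintro ⟨h0, -, h⟩
    refine Finset.eq_empty_of_forall_notMem fun p hp => ?_
    rcases p.eq_empty_or_nonempty with rfl | ⟨x, hx⟩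
    · exact h0 hp
    · exact absurd ((h x).2 ⟨p, hp, hx⟩) (Finset.notMem_empty x)
  · rintro rfl
    simp [IsPartitionOf]

theorem IsPartitionOf.insert_part {α : Type*} {a : α} {s t : Finset α}
    {Q : Finset (Finset α)} (ha : a ∉ s) (ht : t ⊆ s) (hQ : IsPartitionOf (s \ t) Q) :
    IsPartitionOf (insert a s) (insert (insert a t) Q) := by
  obtain ⟨h0, hd, hc⟩ := hQ
  have key : ∀ q ∈ Q, Disjoint (insert a t) q := by
    intro q hq
    rw [Finset.disjoint_left]
    intro x hx hxq
    have := (hc x).2 ⟨q, hq, hxq⟩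
    grind
  refine ⟨?_, ?_, ?_⟩
  · rw [Finset.mem_insert, not_or]
    exact ⟨(Finset.insert_ne_empty a t).symm, h0⟩
  · intro p hp q hq hpq
    rcases Finset.mem_insert.1 hp with rfl | hp <;> rcases Finset.mem_insert.1 hq with rfl | hq
    · exact absurd rfl hpq
    · exact key q hq
    · exact (key p hp).symm
    · exact hd p hp q hq hpq
  · intro x
    have := hc x
    simp only [Finset.mem_insert, exists_eq_or_imp, ← this, Finset.mem_sdiff]
    have := @ht x
    tauto

theorem IsPartitionOf.erase_part {α : Type*} {a : α} {s p : Finset α}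
    {P : Finset (Finset α)} (ha : a ∉ s) (hP : IsPartitionOf (insert a s) P) (hp : p ∈ P)
    (hap : a ∈ p) : IsPartitionOf (s \ p.erase a) (P.erase p) := by
  obtain ⟨h0, hd, hc⟩ := hP
  refine ⟨fun h => h0 (Finset.mem_of_mem_erase h), fun q hq r hr => hd q
    (Finset.mem_of_mem_erase hq) r (Finset.mem_of_mem_erase hr), fun x => ?_⟩
  have hx := hc x
  have hdis : ∀ q ∈ P, q ≠ p → x ∈ q → x ∉ p := fun q hq hqp hxq =>
    Finset.disjoint_left.1 (hd q hq p hp hqp) hxq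
  constructor
  · intro h
    rw [Finset.mem_sdiff] at h
    obtain ⟨q, hq, hxq⟩ := hx.1 (Finset.mem_insert_of_mem h.1)
    refine ⟨q, Finset.mem_erase.2 ⟨?_, hq⟩, hxq⟩
    rintro rfl
    exact h.2 (Finset.mem_erase.2 ⟨fun hxa => ha (hxa ▸ h.1), hxq⟩)
  · rintro ⟨q, hq, hxq⟩
    rw [Finset.mem_erase] at hq
    have hxp := hdis q hq.2 hq.1 hxq
    have hxs := hx.2 ⟨q, hq.2, hxq⟩
    grind

theorem card_partitionsOf_insert {α : Type*} [Fintype α] {a : α} {s : Finset α} (ha : a ∉ s) :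
    (partitionsOf (insert a s)).card = ∑ t ∈ s.powerset, (partitionsOf (s \ t)).card := by
  rw [← Finset.card_sigma]
  symm
  refine Finset.card_nbij (fun x => insert (insert a x.1) x.2) ?_ ?_ ?_
  · rintro ⟨t, Q⟩ h
    rw [Finset.mem_coe, Finset.mem_sigma, Finset.mem_powerset, mem_partitionsOf] at h
    exact mem_partitionsOf.2 (h.2.insert_part ha h.1)
  · have haQ : ∀ {t : Finset α} {Q : Finset (Finset α)}, IsPartitionOf (s \ t) Q →
        ∀ q ∈ Q, a ∉ q := fun hQ q hq haq =>
      ha (Finset.mem_sdiff.1 ((hQ.2.2 a).2 ⟨q, hq, haq⟩)).1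
    rintro ⟨t, Q⟩ h ⟨t', Q'⟩ h' heq
    rw [Finset.mem_coe, Finset.mem_sigma, Finset.mem_powerset, mem_partitionsOf] at h h'
    simp only at h h' heq
    have hQ := haQ h.2
    have hQ' := haQ h'.2
    have hins : insert a t = insert a t' := by
      have : insert a t ∈ insert (insert a t') Q' := heq ▸ Finset.mem_insert_self _ _
      rcases Finset.mem_insert.1 this with h1 | h1
      · exact h1
      · exact absurd (Finset.mem_insert_self a t) (hQ' _ h1)
    have htt : t = t' := by
      rw [← Finset.erase_insert (fun hat => ha (h.1 hat)), hins,
        Finset.erase_insert (fun hat => ha (h'.1 hat))]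
    subst htt
    have hQQ : Q = Q' := by
      rw [← Finset.erase_insert (fun hm => hQ _ hm (Finset.mem_insert_self a t)), heq,
        Finset.erase_insert (fun hm => hQ' _ hm (Finset.mem_insert_self a t))]
    rw [hQQ]
  · intro P hP
    rw [Finset.mem_coe, mem_partitionsOf] at hP
    obtain ⟨p, hp, hap⟩ := (hP.2.2 a).1 (Finset.mem_insert_self a s)
    refine ⟨⟨p.erase a, P.erase p⟩, ?_, ?_⟩
    · rw [Finset.mem_coe, Finset.mem_sigma, Finset.mem_powerset, mem_partitionsOf]
      refine ⟨fun x hx => ?_, hP.erase_part ha hp hap⟩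
      rw [Finset.mem_erase] at hx
      exact Finset.mem_of_mem_insert_of_ne ((hP.2.2 x).2 ⟨p, hp, hx.2⟩) hx.1
    · simp only [Finset.insert_erase hap, Finset.insert_erase hp]

theorem card_partitionsOf {α : Type*} [Fintype α] (s : Finset α) :
    (partitionsOf s).card = Nat.bell s.card := by
  induction s using Finset.strongInduction with
  | H s ih =>
    rcases s.eq_empty_or_nonempty with rfl | ⟨a, ha⟩
    · simp [partitionsOf_empty]
    · obtain ⟨u, hau, rfl⟩ : ∃ u, a ∉ u ∧ insert a u = s :=
        ⟨s.erase a, Finset.notMem_erase a s, Finset.insert_erase ha⟩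
      have hcard : ∀ t ∈ u.powerset,
          (partitionsOf (u \ t)).card = Nat.bell (u.card - t.card) := by
        intro t ht
        rw [ih (u \ t) (lt_of_le_of_lt Finset.sdiff_subset (Finset.ssubset_insert hau)),
          Finset.card_sdiff_of_subset (Finset.mem_powerset.1 ht)]
      rw [card_partitionsOf_insert hau, Finset.sum_congr rfl hcard,
        Finset.sum_powerset_apply_card (fun k => Nat.bell (u.card - k)),
        Finset.card_insert_of_notMem hau, Nat.bell_succ, Nat.range_succ_eq_Iic]
      simp

theorem bell_eq_nat_bell (n : ℕ) : bell n = Nat.bell n := by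
  have h := card_partitionsOf (Finset.univ : Finset (Fin n))
  rw [Finset.card_fin] at h
  rw [← h, bell, partitionsOf]
  congr 1
  ext P
  rw [Finset.mem_filter, Finset.mem_filter]
  simp [IsPartition, IsPartitionOf]

/-- Dobiński's formula. -/
theorem hasSum_pow_div_factorial_bell (n : ℕ) :
    HasSum (fun k : ℕ => (k : ℝ) ^ n / (k.factorial : ℝ)) (Real.exp 1 * Nat.bell n) := by
  induction n using Nat.strong_induction_on with
  | _ n ih =>
    rcases n with _ | n
    · have := NormedSpace.expSeries_div_hasSum_exp (1 : ℝ)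
      rw [← Real.exp_eq_exp_ℝ] at this
      simpa using this
    · rw [← hasSum_nat_add_iff' 1]
      have h : HasSum (fun k : ℕ => ∑ j ∈ Finset.range (n + 1),
          (n.choose j : ℝ) * ((k : ℝ) ^ (n - j) / (k.factorial : ℝ)))
          (∑ j ∈ Finset.range (n + 1), (n.choose j : ℝ) * (Real.exp 1 * Nat.bell (n - j))) :=
        hasSum_sum fun j _ => (ih (n - j) (by omega)).mul_left _
      convert! h using 1
      · ext k
        have hk : (k : ℝ) + 1 ≠ 0 := by positivity
        have hf : (k.factorial : ℝ) ≠ 0 := by positivity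
        have : ((k : ℝ) + 1) ^ n = ∑ j ∈ Finset.range (n + 1),
            (n.choose j : ℝ) * (k : ℝ) ^ (n - j) := by
          rw [add_comm, add_pow]
          exact Finset.sum_congr rfl fun j _ => by ring
        simp_rw [← mul_div_assoc]
        rw [← Finset.sum_div, ← this, Nat.factorial_succ]
        push_cast
        rw [pow_succ', mul_div_mul_left _ _ hk]
      · rw [Nat.bell_succ, ← Nat.range_succ_eq_Iic]
        push_cast
        rw [Finset.mul_sum]
        simp only [Finset.range_one, Finset.sum_singleton]
        simp
        exact Finset.sum_congr rfl fun j _ => by ring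

theorem nat_bell_pos (n : ℕ) : 0 < Nat.bell n := by
  induction n using Nat.strong_induction_on with
  | _ n ih =>
    rcases n with _ | n
    · simp
    · rw [Nat.bell_succ]
      exact Finset.sum_pos (fun j hj => Nat.mul_pos (Nat.choose_pos (Finset.mem_Iic.1 hj))
        (ih _ (by omega))) ⟨0, by simp⟩

theorem nat_bell_quadratic_nonneg (n : ℕ) (t : ℝ) :
    0 ≤ (Nat.bell (n + 2) : ℝ) - 2 * t * Nat.bell (n + 1) + t ^ 2 * Nat.bell n := by
  have h := ((hasSum_pow_div_factorial_bell (n + 2)).sub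
    ((hasSum_pow_div_factorial_bell (n + 1)).mul_left (2 * t))).add
    ((hasSum_pow_div_factorial_bell n).mul_left (t ^ 2))
  have hnn := h.nonneg fun k => by
    have : (k : ℝ) ^ (n + 2) / (k.factorial : ℝ) - 2 * t * (k ^ (n + 1) / (k.factorial : ℝ))
        + t ^ 2 * (k ^ n / (k.factorial : ℝ)) = k ^ n * (k - t) ^ 2 / (k.factorial : ℝ) := by
      ring
    rw [this]
    positivity
  refine (mul_nonneg_iff_of_pos_left (Real.exp_pos 1)).1 ?_
  linarith

/-- The ratio of consecutive Bell numbers. -/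
noncomputable def bellRatio (n : ℕ) : ℝ := (Nat.bell (n + 1) : ℝ) / Nat.bell n

theorem bellRatio_pos (n : ℕ) : 0 < bellRatio n :=
  div_pos (Nat.cast_pos.2 (nat_bell_pos _)) (Nat.cast_pos.2 (nat_bell_pos _))

theorem nat_bell_succ_eq_bellRatio_mul (n : ℕ) :
    (Nat.bell (n + 1) : ℝ) = bellRatio n * Nat.bell n :=
  (div_mul_cancel₀ _ (Nat.cast_pos.2 (nat_bell_pos n)).ne').symm

theorem bellRatio_monotone : Monotone bellRatio := by
  refine monotone_nat_of_le_succ fun n => ?_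
  have h := nat_bell_quadratic_nonneg n (bellRatio n)
  have hpos : (0 : ℝ) < Nat.bell (n + 1) := Nat.cast_pos.2 (nat_bell_pos _)
  have h1 := nat_bell_succ_eq_bellRatio_mul n
  have h2 := nat_bell_succ_eq_bellRatio_mul (n + 1)
  refine le_of_mul_le_mul_right ?_ hpos
  rw [← h2]
  linear_combination h - bellRatio n * h1

theorem nat_bell_le_bellRatio_pow_mul {n k : ℕ} (hk : k ≤ n) :
    (Nat.bell n : ℝ) ≤ bellRatio n ^ k * Nat.bell (n - k) := by
  induction k with
  | zero => simp
  | succ k ih =>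
    refine (ih (by omega)).trans ?_
    have hsub : n - k = n - (k + 1) + 1 := by omega
    rw [hsub, nat_bell_succ_eq_bellRatio_mul, pow_succ, mul_assoc]
    have hr := (bellRatio_pos n).le
    gcongr
    exact bellRatio_monotone (by omega)

theorem one_add_inv_bellRatio_pow_le (n : ℕ) : (1 + (bellRatio n)⁻¹) ^ n ≤ bellRatio n := by
  have hr := bellRatio_pos n
  have hB : (0 : ℝ) < Nat.bell n := Nat.cast_pos.2 (nat_bell_pos n)
  refine le_of_mul_le_mul_right ?_ hB
  rw [← nat_bell_succ_eq_bellRatio_mul, Nat.bell_succ, ← Nat.range_succ_eq_Iic, add_comm,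
    add_pow, Finset.sum_mul]
  push_cast
  refine Finset.sum_le_sum fun k hk => ?_
  have h := nat_bell_le_bellRatio_pow_mul (Nat.lt_succ_iff.1 (Finset.mem_range.1 hk))
  rw [one_pow, mul_one, inv_pow, mul_comm _ (n.choose k : ℝ), mul_assoc]
  gcongr
  rwa [inv_mul_le_iff₀ (by positivity)]

theorem stmt10 (n : ℕ) (hn : 2 ≤ n) :
    (n : ℝ) * (bell n : ℝ) ≤ 2 * Real.log n * (bell (n + 1) : ℝ) := by
  rw [bell_eq_nat_bell, bell_eq_nat_bell, nat_bell_succ_eq_bellRatio_mul, ← mul_assoc]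
  refine mul_le_mul_of_nonneg_right ?_ (Nat.cast_nonneg _)
  by_contra! hlt
  have hr := bellRatio_pos n
  have hpow := one_add_inv_bellRatio_pow_le n
  set r := bellRatio n
  have hn2 : (2 : ℝ) ≤ n := by exact_mod_cast hn
  have hlog : 1 < 2 * Real.log n := by
    have := Real.log_le_log two_pos hn2
    linarith [Real.log_two_gt_d9]
  have hlog_le : 2 * Real.log n ≤ n := by
    have h := Real.log_le_sub_one_of_pos (show (0 : ℝ) < n / 2 by positivity)
    rw [Real.log_div (by positivity) two_ne_zero] at h
    linarith [Real.log_two_lt_d9]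
  have hrn : r < n := by nlinarith
  have hlogr : Real.log r < Real.log n := Real.log_lt_log hr hrn
  have hlow : n * (r + 1)⁻¹ ≤ Real.log r := by
    have h1 := Real.log_le_log (by positivity) hpow
    rw [Real.log_pow] at h1
    have h2 := Real.one_sub_inv_le_log_of_pos (show 0 < 1 + r⁻¹ by positivity)
    have h3 : 1 - (1 + r⁻¹)⁻¹ = (r + 1)⁻¹ := by
      field_simp
      ring
    rw [h3] at h2
    exact (mul_le_mul_of_nonneg_left h2 (by positivity)).trans h1
  have hlt' := hlow.trans_lt hlogr
  rw [← div_eq_mul_inv, div_lt_iff₀ (by positivity)] at hlt'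
  linarith
end

section
/- There exists a constant c′ > 0 such that for every integer n ≥ 2 and every partition P of [n], the number of partitions of [n] that contain no part of P (i.e., partitions Q such that no part of Q equals a part of P) is at least c′·e^{−(3/2)·(log n)²}·B_n, where log denotes the natural logarithm. -/
open scoped Classical

namespace IsPartition

variable {n : ℕ} {P Q T : Finset (Finset (Fin n))}

/-- Two parts of a partition sharing a point coincide. -/
theorem eq_of_mem (hP : IsPartition P) {p q : Finset (Fin n)} (hp : p ∈ P) (hq : q ∈ P)
    {x : Fin n} (hxp : x ∈ p) (hxq : x ∈ q) : p = q := by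
  by_contra h
  exact Finset.disjoint_left.1 (hP.2.1 p hp q hq h) hxp hxq

theorem nonempty_of_mem (hP : IsPartition P) {p : Finset (Fin n)} (hp : p ∈ P) :
    p.Nonempty := by
  rw [Finset.nonempty_iff_ne_empty]
  rintro rfl
  exact hP.1 hp

end IsPartition

/-- The union of the sets of `Q` that contain `x`; for a partition `Q`, the part containing `x`. -/
def partAt {n : ℕ} (Q : Finset (Finset (Fin n))) (x : Fin n) : Finset (Fin n) :=
  (Q.filter fun q => x ∈ q).biUnion id

/-- Replace the sets of `T` by their union. -/
def mergeParts {n : ℕ} (Q T : Finset (Finset (Fin n))) : Finset (Finset (Fin n)) :=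
  insert (T.biUnion id) (Q \ T)

/-- The partitions of `Fin n` having no part in `P`. -/
noncomputable def avoiding {n : ℕ} (P : Finset (Finset (Fin n))) : Finset (Finset (Finset (Fin n))) :=
  Finset.univ.filter fun Q => IsPartition Q ∧ ∀ q ∈ Q, q ∉ P

namespace IsPartition

variable {n : ℕ} {P Q T : Finset (Finset (Fin n))}

theorem partAt_eq (hQ : IsPartition Q) {q : Finset (Fin n)} (hq : q ∈ Q) {x : Fin n}
    (hx : x ∈ q) : partAt Q x = q := by
  ext y
  simp only [partAt, Finset.mem_biUnion, Finset.mem_filter, id]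
  constructor
  · rintro ⟨r, ⟨hr, hxr⟩, hy⟩
    rwa [hQ.eq_of_mem hq hr hx hxr]
  · exact fun hy => ⟨q, ⟨hq, hx⟩, hy⟩

theorem mergeParts (hQ : IsPartition Q) (hT : T ⊆ Q) (hne : T.Nonempty) :
    IsPartition (mergeParts Q T) := by
  have key : ∀ q ∈ Q \ T, Disjoint (T.biUnion id) q := by
    intro q hq
    rw [Finset.mem_sdiff] at hq
    rw [Finset.disjoint_biUnion_left]
    intro t ht
    exact hQ.2.1 t (hT ht) q hq.1 (fun h => hq.2 (h ▸ ht))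
  refine ⟨?_, ?_, ?_⟩
  · rw [_root_.mergeParts, Finset.mem_insert, not_or]
    refine ⟨?_, fun h => hQ.1 (Finset.mem_sdiff.1 h).1⟩
    obtain ⟨t, ht⟩ := hne
    obtain ⟨x, hx⟩ := hQ.nonempty_of_mem (hT ht)
    exact fun h => Finset.notMem_empty x (h ▸ Finset.mem_biUnion.2 ⟨t, ht, hx⟩)
  · intro p hp q hq hpq
    rw [_root_.mergeParts, Finset.mem_insert] at hp hq
    rcases hp with rfl | hp <;> rcases hq with rfl | hq
    · exact absurd rfl hpq
    · exact key q hq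
    · exact (key p hp).symm
    · exact hQ.2.1 p (Finset.mem_sdiff.1 hp).1 q (Finset.mem_sdiff.1 hq).1 hpq
  · intro x
    obtain ⟨q, hq, hx⟩ := hQ.2.2 x
    by_cases h : q ∈ T
    · exact ⟨_, Finset.mem_insert_self _ _, Finset.mem_biUnion.2 ⟨q, h, hx⟩⟩
    · exact ⟨q, Finset.mem_insert_of_mem (Finset.mem_sdiff.2 ⟨hq, h⟩), hx⟩

/-- The union of two or more parts of `Q` is not a part of a partition sharing one of them. -/
theorem biUnion_notMem (hP : IsPartition P) (hQ : IsPartition Q) (hT : T ⊆ Q)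
    {p r : Finset (Fin n)} (hp : p ∈ T) (hr : r ∈ T) (hpr : p ≠ r) (hpP : p ∈ P) :
    T.biUnion id ∉ P := by
  intro hU
  obtain ⟨x, hx⟩ := hQ.nonempty_of_mem (hT hp)
  obtain ⟨y, hy⟩ := hQ.nonempty_of_mem (hT hr)
  have h := hP.eq_of_mem hpP hU hx (Finset.mem_biUnion.2 ⟨p, hp, hx⟩)
  refine hpr (hQ.eq_of_mem (hT hp) (hT hr) ?_ hy)
  rw [h]
  exact Finset.mem_biUnion.2 ⟨r, hr, hy⟩

theorem mergeParts_mem_avoiding (hP : IsPartition P) (hQ : IsPartition Q) (hT : T ⊆ Q)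
    (hC : Q ∩ P ⊆ T) {p r : Finset (Fin n)} (hp : p ∈ T) (hr : r ∈ T) (hpr : p ≠ r)
    (hpP : p ∈ P) : _root_.mergeParts Q T ∈ avoiding P := by
  rw [avoiding, Finset.mem_filter]
  refine ⟨Finset.mem_univ _, hQ.mergeParts hT ⟨p, hp⟩, ?_⟩
  intro q hq
  rw [_root_.mergeParts, Finset.mem_insert] at hq
  rcases hq with rfl | hq
  · exact hP.biUnion_notMem hQ hT hp hr hpr hpP
  · rw [Finset.mem_sdiff] at hq
    exact fun h => hq.2 (hC (Finset.mem_inter.2 ⟨hq.1, h⟩))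

/-- A partition is recovered from the result of merging two or more of its parts. -/
theorem erase_mergeParts_union (hQ : IsPartition Q) (hT : T ⊆ Q)
    {p r : Finset (Fin n)} (hp : p ∈ T) (hr : r ∈ T) (hpr : p ≠ r) :
    (_root_.mergeParts Q T).erase (T.biUnion id) ∪ T = Q := by
  have hU : T.biUnion id ∉ Q \ T := fun h =>
    hQ.biUnion_notMem hQ hT hp hr hpr (hT hp) (Finset.mem_sdiff.1 h).1
  rw [_root_.mergeParts, Finset.erase_insert hU, Finset.sdiff_union_of_subset hT]

/-- The partitions are those avoiding `P`, the trivial one, and those obtained from a partition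
avoiding `P` by splitting one part, either into parts of `P` or into a part of `P` and the rest. -/
theorem subset_union_image (hP : IsPartition P) :
    (Finset.univ.filter fun Q : Finset (Finset (Fin n)) => IsPartition Q) ⊆
      ((avoiding P ∪ {{Finset.univ}}) ∪
        (avoiding P ×ˢ Finset.univ).image (fun z : Finset (Finset (Fin n)) × Fin n =>
          z.1.erase (partAt z.1 z.2) ∪ P.filter fun q => q ⊆ partAt z.1 z.2)) ∪
        (avoiding P ×ˢ Finset.univ).image (fun z : Finset (Finset (Fin n)) × Fin n =>
          z.1.erase (partAt z.1 z.2) ∪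
            {partAt P z.2, partAt z.1 z.2 \ partAt P z.2}) := by
  intro Q hQ
  replace hQ : IsPartition Q := (Finset.mem_filter.1 hQ).2
  by_cases h0 : ∀ q ∈ Q, q ∉ P
  · exact Finset.mem_union_left _ (Finset.mem_union_left _ (Finset.mem_union_left _
      (Finset.mem_filter.2 ⟨Finset.mem_univ _, hQ, h0⟩)))
  push Not at h0
  obtain ⟨p, hpQ, hpP⟩ := h0
  obtain ⟨x, hx⟩ := hQ.nonempty_of_mem hpQ
  by_cases h1 : ∃ r ∈ Q ∩ P, p ≠ r
  · obtain ⟨r, hr, hpr⟩ := h1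
    have hp : p ∈ Q ∩ P := Finset.mem_inter.2 ⟨hpQ, hpP⟩
    have hT : Q ∩ P ⊆ Q := Finset.inter_subset_left
    refine Finset.mem_union_left _ (Finset.mem_union_right _ (Finset.mem_image.2
      ⟨(_root_.mergeParts Q (Q ∩ P), x), ?_, ?_⟩))
    · exact Finset.mem_product.2
        ⟨hP.mergeParts_mem_avoiding hQ hT subset_rfl hp hr hpr hpP, Finset.mem_univ _⟩
    · have hU : partAt (_root_.mergeParts Q (Q ∩ P)) x = (Q ∩ P).biUnion id :=
        (hQ.mergeParts hT ⟨p, hp⟩).partAt_eq (Finset.mem_insert_self _ _)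
          (Finset.mem_biUnion.2 ⟨p, hp, hx⟩)
      have hF : (P.filter fun q => q ⊆ (Q ∩ P).biUnion id) = Q ∩ P := by
        ext q
        rw [Finset.mem_filter]
        constructor
        · rintro ⟨hq, hsub⟩
          obtain ⟨y, hy⟩ := hP.nonempty_of_mem hq
          obtain ⟨c, hc, hyc⟩ := Finset.mem_biUnion.1 (hsub hy)
          rwa [hP.eq_of_mem hq (Finset.mem_inter.1 hc).2 hy hyc]
        · exact fun hq => ⟨(Finset.mem_inter.1 hq).2, Finset.subset_biUnion_of_mem id hq⟩
      simp only [hU, hF]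
      exact hQ.erase_mergeParts_union hT hp hr hpr
  push Not at h1
  by_cases h2 : ∃ r ∈ Q, p ≠ r
  · obtain ⟨r, hrQ, hpr⟩ := h2
    have hT : ({p, r} : Finset (Finset (Fin n))) ⊆ Q := by
      simp [Finset.insert_subset_iff, hpQ, hrQ]
    have hC : Q ∩ P ⊆ {p, r} := fun q hq => by simp [← h1 q hq]
    have hp : p ∈ ({p, r} : Finset (Finset (Fin n))) := by simp
    have hr : r ∈ ({p, r} : Finset (Finset (Fin n))) := by simp
    refine Finset.mem_union_right _ (Finset.mem_image.2
      ⟨(_root_.mergeParts Q {p, r}, x), ?_, ?_⟩)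
    · exact Finset.mem_product.2
        ⟨hP.mergeParts_mem_avoiding hQ hT hC hp hr hpr hpP, Finset.mem_univ _⟩
    · have hU : partAt (_root_.mergeParts Q {p, r}) x =
          ({p, r} : Finset (Finset (Fin n))).biUnion id :=
        (hQ.mergeParts hT ⟨p, hp⟩).partAt_eq (Finset.mem_insert_self _ _)
          (Finset.mem_biUnion.2 ⟨p, hp, hx⟩)
      have hd : ({p, r} : Finset (Finset (Fin n))).biUnion id \ p = r := by
        rw [Finset.biUnion_insert, Finset.singleton_biUnion, id, id,
          Finset.union_sdiff_cancel_left (hQ.2.1 p hpQ r hrQ hpr)]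
      simp only [hU, hP.partAt_eq hpP hx, hd]
      exact hQ.erase_mergeParts_union hT hp hr hpr
  push Not at h2
  refine Finset.mem_union_left _ (Finset.mem_union_left _ (Finset.mem_union_right _ ?_))
  have hp : p = Finset.univ := by
    ext y
    obtain ⟨q, hq, hy⟩ := hQ.2.2 y
    simpa [h2 q hq] using hy
  rw [Finset.mem_singleton, Finset.eq_singleton_iff_unique_mem, ← hp]
  exact ⟨hpQ, fun q hq => (h2 q hq).symm⟩

theorem avoiding_nonempty (hn : 2 ≤ n) (hP : IsPartition P) : (avoiding P).Nonempty := by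
  have x₀ : Fin n := ⟨0, by omega⟩
  by_cases hu : Finset.univ ∈ P
  · refine ⟨Finset.univ.image fun x : Fin n => {x}, Finset.mem_filter.2
      ⟨Finset.mem_univ _, ⟨?_, ?_, ?_⟩, ?_⟩⟩
    · simp
    · simp only [Finset.mem_image, Finset.mem_univ, true_and]
      rintro _ ⟨x, rfl⟩ _ ⟨y, rfl⟩ h
      exact Finset.disjoint_singleton.2 fun e => h (by rw [e])
    · exact fun x => ⟨{x}, by simp, by simp⟩
    · simp only [Finset.mem_image, Finset.mem_univ, true_and]
      rintro _ ⟨x, rfl⟩ h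
      have h' := congrArg Finset.card
        (hP.eq_of_mem h hu (Finset.mem_singleton_self x) (Finset.mem_univ x))
      simp only [Finset.card_singleton, Finset.card_univ, Fintype.card_fin] at h'
      omega
  · refine ⟨{Finset.univ}, Finset.mem_filter.2 ⟨Finset.mem_univ _, ⟨?_, ?_, ?_⟩, ?_⟩⟩
    · exact fun h => Finset.notMem_empty x₀ (Finset.mem_singleton.1 h ▸ Finset.mem_univ x₀)
    · intro p hp q hq h
      exact absurd ((Finset.mem_singleton.1 hp).trans (Finset.mem_singleton.1 hq).symm) h
    · exact fun x => ⟨_, Finset.mem_singleton_self _, Finset.mem_univ x⟩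
    · intro q hq
      rwa [Finset.mem_singleton.1 hq]

theorem bell_le (hn : 2 ≤ n) (hP : IsPartition P) :
    bell n ≤ (2 * n + 2) * (avoiding P).card := by
  have h1 : 1 ≤ (avoiding P).card := (hP.avoiding_nonempty hn).card_pos
  have hc : ∀ f : Finset (Finset (Fin n)) × Fin n → Finset (Finset (Fin n)),
      ((avoiding P ×ˢ Finset.univ).image f).card ≤ (avoiding P).card * n := fun f =>
    Finset.card_image_le.trans (by simp)
  calc bell n ≤ _ := Finset.card_le_card hP.subset_union_image
    _ ≤ (((avoiding P).card + 1) + (avoiding P).card * n) + (avoiding P).card * n := by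
      refine (Finset.card_union_le _ _).trans (add_le_add ?_ (hc _))
      refine (Finset.card_union_le _ _).trans (add_le_add ?_ (hc _))
      exact (Finset.card_union_le _ _).trans (by simp)
    _ ≤ (2 * n + 2) * (avoiding P).card := by nlinarith

end IsPartition

theorem stmt11 :
    ∃ c' : ℝ, 0 < c' ∧ ∀ n : ℕ, 2 ≤ n → ∀ P : Finset (Finset (Fin n)), IsPartition P →
      c' * Real.exp (-(3 / 2) * Real.log n ^ 2) * (bell n : ℝ) ≤
        (((Finset.univ.filter fun Q : Finset (Finset (Fin n)) =>
          IsPartition Q ∧ ∀ q ∈ Q, q ∉ P).card : ℝ)) := by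
  refine ⟨Real.exp (-1) / 4, by positivity, fun n hn P hP => ?_⟩
  change _ ≤ ((avoiding P).card : ℝ)
  have hn' : (2 : ℝ) ≤ n := by exact_mod_cast hn
  have hb : (bell n : ℝ) ≤ (2 * n + 2) * (avoiding P).card := by
    exact_mod_cast hP.bell_le hn
  have he : Real.exp (-1) * Real.exp (-(3 / 2) * Real.log n ^ 2) * n ≤ 1 := by
    nth_rewrite 2 [← Real.exp_log (show (0 : ℝ) < n by linarith)]
    rw [← Real.exp_add, ← Real.exp_add, Real.exp_le_one_iff]
    nlinarith [sq_nonneg (Real.log n - 1 / 3)]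
  set E := Real.exp (-1) * Real.exp (-(3 / 2) * Real.log n ^ 2) with hE
  have hE0 : 0 ≤ E := by positivity
  have hD : (0 : ℝ) ≤ (avoiding P).card := by positivity
  calc Real.exp (-1) / 4 * Real.exp (-(3 / 2) * Real.log n ^ 2) * (bell n : ℝ)
      = E / 4 * bell n := by rw [hE]; ring
    _ ≤ E / 4 * ((2 * n + 2) * (avoiding P).card) := by gcongr
    _ ≤ E / 4 * ((4 * n) * (avoiding P).card) := by gcongr; linarith
    _ = E * n * (avoiding P).card := by ring
    _ ≤ 1 * (avoiding P).card := by gcongr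
    _ = (avoiding P).card := one_mul _
end

section
/- For every integer n ≥ 50 and every integer s with 1 ≤ s ≤ n−2, the Bell numbers satisfy B_n ≥ (n/(6·log n))^s · B_{n−s}, where log denotes the natural logarithm. -/
open scoped Classical

/-- The partition of `Fin n` into the equivalence classes of a setoid. -/
noncomputable def classFinset {n : ℕ} (r : Setoid (Fin n)) : Finset (Finset (Fin n)) :=
  Finset.univ.image fun x => Finset.univ.filter fun y => r x y

theorem isPartition_classFinset {n : ℕ} (r : Setoid (Fin n)) : IsPartition (classFinset r) := by
  refine ⟨?_, ?_, ?_⟩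
  · intro h
    obtain ⟨x, -, hx⟩ := Finset.mem_image.1 h
    have : x ∈ (∅ : Finset (Fin n)) := by
      rw [← hx]
      simp
    simp at this
  · intro p hp q hq hpq
    obtain ⟨x, -, rfl⟩ := Finset.mem_image.1 hp
    obtain ⟨y, -, rfl⟩ := Finset.mem_image.1 hq
    rw [Finset.disjoint_left]
    intro z hz hz'
    simp only [Finset.mem_filter, Finset.mem_univ, true_and] at hz hz'
    apply hpq
    ext w
    simp only [Finset.mem_filter, Finset.mem_univ, true_and]
    have hxy : r x y := r.trans hz (r.symm hz')
    exact ⟨fun h => r.trans (r.symm hxy) h, fun h => r.trans hxy h⟩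
  · intro x
    exact ⟨_, Finset.mem_image_of_mem _ (Finset.mem_univ x), by simp⟩

theorem classFinset_injective (n : ℕ) :
    Function.Injective (classFinset : Setoid (Fin n) → Finset (Finset (Fin n))) := by
  intro r t h
  ext x y
  have key : ∀ r t : Setoid (Fin n), classFinset r = classFinset t → r x y → t x y := by
    intro r t h hxy
    have hm : (Finset.univ.filter fun y => r x y) ∈ classFinset t := by
      rw [← h]
      exact Finset.mem_image_of_mem _ (Finset.mem_univ x)
    obtain ⟨z, -, hz⟩ := Finset.mem_image.1 hm
    have hzx : t z x := by
      have : x ∈ Finset.univ.filter fun y => t z y := by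
        rw [hz]
        simp
      simpa using this
    have hzy : t z y := by
      have : y ∈ Finset.univ.filter fun y => t z y := by
        rw [hz]
        simpa using hxy
      simpa using this
    exact t.trans (t.symm hzx) hzy
  exact ⟨key r t h, key t r h.symm⟩

theorem exists_classFinset_eq {n : ℕ} {P : Finset (Finset (Fin n))} (hP : IsPartition P) :
    ∃ r : Setoid (Fin n), classFinset r = P := by
  obtain ⟨hne, hdisj, hcov⟩ := hP
  have huniq : ∀ p ∈ P, ∀ q ∈ P, ∀ x, x ∈ p → x ∈ q → p = q := by
    intro p hp q hq x hxp hxq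
    by_contra hpq
    exact Finset.disjoint_left.1 (hdisj p hp q hq hpq) hxp hxq
  choose b hbP hb using hcov
  have hfib : ∀ x, (Finset.univ.filter fun y => Setoid.ker b x y) = b x := by
    intro x
    ext y
    simp only [Finset.mem_filter, Finset.mem_univ, true_and, Setoid.ker_def]
    exact ⟨fun h => h ▸ hb y, fun h => huniq _ (hbP x) _ (hbP y) y h (hb y)⟩
  refine ⟨Setoid.ker b, ?_⟩
  ext p
  simp only [classFinset, hfib, Finset.mem_image, Finset.mem_univ, true_and]
  constructor
  · rintro ⟨x, rfl⟩
    exact hbP x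
  · intro hp
    obtain ⟨x, hx⟩ := Finset.nonempty_iff_ne_empty.2 (fun h => hne (h ▸ hp))
    exact ⟨x, huniq _ (hbP x) _ hp x (hb x) hx⟩

theorem bell_eq_card_setoid (n : ℕ) [Fintype (Setoid (Fin n))] :
    bell n = Fintype.card (Setoid (Fin n)) := by
  rw [← Finset.card_univ, bell]
  symm
  refine Finset.card_bij (fun r _ => classFinset r) ?_ ?_ ?_
  · intro r _
    simpa using isPartition_classFinset r
  · intro r _ t _ h
    exact classFinset_injective n h
  · intro P hP
    obtain ⟨r, hr⟩ := exists_classFinset_eq (Finset.mem_filter.1 hP).2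
    exact ⟨r, Finset.mem_univ r, hr⟩

/-- Functions with kernel `r` are the embeddings of the quotient by `r`. -/
def kerEqEquivEmbedding {α β : Type*} (r : Setoid α) :
    {f : α → β // Setoid.ker f = r} ≃ (Quotient r ↪ β) where
  toFun f := ⟨Quotient.lift f.1 fun a b h => by
      have h' : r a b := h
      rwa [← f.2, Setoid.ker_def] at h', by
    rintro ⟨a⟩ ⟨b⟩ h
    refine Quotient.sound (show r a b from ?_)
    rw [← f.2, Setoid.ker_def]
    exact h⟩
  invFun g := ⟨fun a => g ⟦a⟧, by
    ext a b
    rw [Setoid.ker_def, g.injective.eq_iff]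
    exact Quotient.eq⟩
  left_inv f := rfl
  right_inv g := by
    ext ⟨a⟩
    rfl

theorem pow_eq_sum_descFactorial (n k : ℕ) [Fintype (Setoid (Fin n))] :
    k ^ n = ∑ r : Setoid (Fin n), k.descFactorial (Fintype.card (Quotient r)) := by
  calc k ^ n = Fintype.card (Fin n → Fin k) := by simp
    _ = ∑ r : Setoid (Fin n), Fintype.card {f : Fin n → Fin k // Setoid.ker f = r} := by
        rw [← Fintype.card_sigma]
        exact Fintype.card_congr (Equiv.sigmaFiberEquiv _).symm
    _ = _ := by
        refine Finset.sum_congr rfl fun r _ => ?_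
        rw [Fintype.card_congr (kerEqEquivEmbedding r), Fintype.card_embedding_eq,
          Fintype.card_fin]

theorem hasSum_descFactorial_div_factorial (j : ℕ) :
    HasSum (fun k : ℕ => (k.descFactorial j : ℝ) / (k.factorial : ℝ)) (Real.exp 1) := by
  rw [← hasSum_nat_add_iff' j, Finset.sum_eq_zero, sub_zero]
  · have h := NormedSpace.expSeries_div_hasSum_exp (1 : ℝ)
    rw [← Real.exp_eq_exp_ℝ] at h
    refine h.congr_fun fun k => ?_
    have h := Nat.factorial_mul_descFactorial (Nat.le_add_left j k)
    rw [Nat.add_sub_cancel] at h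
    have h1 : (k.factorial : ℝ) ≠ 0 := by positivity
    have h2 : ((k + j).factorial : ℝ) ≠ 0 := by positivity
    rw [one_pow, div_eq_div_iff h2 h1, ← h]
    push_cast
    ring
  · intro i hi
    rw [Nat.descFactorial_of_lt (Finset.mem_range.1 hi)]
    simp

/-- Dobiński's formula. -/
theorem hasSum_pow_div_factorial (n : ℕ) :
    HasSum (fun k : ℕ => (k : ℝ) ^ n / (k.factorial : ℝ)) (bell n * Real.exp 1) := by
  have : Fintype (Setoid (Fin n)) := Fintype.ofInjective _ (classFinset_injective n)
  have h := hasSum_sum (s := (Finset.univ : Finset (Setoid (Fin n))))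
    fun r _ => hasSum_descFactorial_div_factorial (Fintype.card (Quotient r))
  rw [Finset.sum_const, Finset.card_univ, ← bell_eq_card_setoid, nsmul_eq_mul] at h
  refine h.congr_fun fun k => ?_
  rw [← Finset.sum_div, ← Nat.cast_pow, pow_eq_sum_descFactorial]
  push_cast
  rfl

theorem pow_mul_pow_le_weighted {x c : ℝ} (hx : 0 ≤ x) (hc : 0 ≤ c) {n s : ℕ} (hn : n ≠ 0)
    (hs : s ≤ n) :
    c ^ s * x ^ (n - s) ≤ (s / n : ℝ) * c ^ n + ((n - s : ℕ) / n : ℝ) * x ^ n := by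
  have hn' : (n : ℝ) ≠ 0 := by exact_mod_cast hn
  have key : ∀ {y : ℝ} (_ : 0 ≤ y) (t : ℕ), (y ^ n) ^ (t / n : ℝ) = y ^ t := by
    intro y hy t
    rw [← Real.rpow_natCast y n, ← Real.rpow_mul hy, mul_div_cancel₀ _ hn', Real.rpow_natCast]
  have h := Real.geom_mean_le_arith_mean2_weighted (w₁ := (s / n : ℝ))
    (w₂ := ((n - s : ℕ) / n : ℝ)) (by positivity) (by positivity) (pow_nonneg hc n)
    (pow_nonneg hx n) (by rw [Nat.cast_sub hs]; field_simp; ring)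
  rwa [key hc, key hx] at h

theorem pow_mul_bell_le_of_pow_le_bell {c : ℝ} (hc : 0 ≤ c) {n s : ℕ} (hn : n ≠ 0) (hs : s ≤ n)
    (h : c ^ n ≤ bell n) : c ^ s * bell (n - s) ≤ bell n := by
  have hn' : (0 : ℝ) < n := by positivity
  have hle := hasSum_le (fun k : ℕ => ?_) ((hasSum_pow_div_factorial (n - s)).mul_left (c ^ s))
    (((hasSum_descFactorial_div_factorial 0).mul_left ((s / n : ℝ) * c ^ n)).add
      ((hasSum_pow_div_factorial n).mul_left ((n - s : ℕ) / n : ℝ)))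
  · have he := Real.exp_pos 1
    have hle' : c ^ s * bell (n - s) ≤
        (s / n : ℝ) * c ^ n + ((n - s : ℕ) / n : ℝ) * bell n :=
      le_of_mul_le_mul_right (by linarith) he
    have h1 : (s / n : ℝ) * c ^ n ≤ (s / n : ℝ) * bell n := by gcongr
    have h2 : (s / n : ℝ) * bell n + ((n - s : ℕ) / n : ℝ) * bell n = bell n := by
      rw [Nat.cast_sub hs]
      field_simp
      ring
    linarith
  · have hk := pow_mul_pow_le_weighted (Nat.cast_nonneg k) hc hn hs
    have := div_le_div_of_nonneg_right hk (Nat.cast_nonneg (α := ℝ) k.factorial)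
    simp only [Nat.descFactorial_zero, Nat.cast_one]
    calc _ = c ^ s * (k : ℝ) ^ (n - s) / (k.factorial : ℝ) := by ring
      _ ≤ _ := this
      _ = _ := by ring

theorem exp_succ_le_three_pow {n : ℕ} (hn : 50 ≤ n) : Real.exp (n + 1) ≤ 3 ^ n := by
  have he : Real.exp 1 ≤ 2.72 := by linarith [Real.exp_one_lt_d9]
  have h50 : Real.exp ((50 : ℕ) + 1) ≤ 3 ^ 50 := by
    have : Real.exp ((50 : ℕ) + 1) = Real.exp 1 ^ 51 := by
      rw [← Real.exp_nat_mul]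
      norm_num
    rw [this]
    calc Real.exp 1 ^ 51 ≤ 2.72 ^ 51 := by gcongr
      _ ≤ 3 ^ 50 := by norm_num
  induction n, hn using Nat.le_induction with
  | base => exact h50
  | succ m _ ih =>
    push_cast
    rw [Real.exp_add (m + 1 : ℝ), pow_succ]
    have : Real.exp 1 ≤ 3 := by linarith
    gcongr

theorem pow_le_bell {n : ℕ} (hn : 50 ≤ n) :
    ((n : ℝ) / (6 * Real.log n)) ^ n ≤ bell n := by
  have hn' : (50 : ℝ) ≤ n := by exact_mod_cast hn
  have hlog : 0 < Real.log n := Real.log_pos (by linarith)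
  have hlog1 : 1 ≤ Real.log n := by
    rw [Real.le_log_iff_exp_le (by linarith)]
    linarith [Real.exp_one_lt_d9]
  set y : ℝ := n / Real.log n with hy
  have hy1 : 1 ≤ y := by
    rw [hy, le_div_iff₀ hlog]
    linarith [Real.log_le_sub_one_of_pos (show (0 : ℝ) < n by linarith)]
  have hyn : y ≤ n := div_le_self (by linarith) hlog1
  set m := ⌊y⌋₊
  have hm1 : (1 : ℝ) ≤ m := by exact_mod_cast Nat.le_floor (by simpa using hy1)
  have hmy : (m : ℝ) ≤ y := Nat.floor_le (by linarith)
  have hym : y ≤ 2 * m := by linarith [Nat.lt_floor_add_one y]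
  have hfact : (m.factorial : ℝ) ≤ Real.exp n :=
    calc (m.factorial : ℝ) ≤ (m : ℝ) ^ m := by exact_mod_cast Nat.factorial_le_pow m
      _ ≤ (n : ℝ) ^ m := pow_le_pow_left₀ m.cast_nonneg (hmy.trans hyn) m
      _ = Real.exp (m * Real.log n) := by
          rw [Real.exp_nat_mul, Real.exp_log (by linarith)]
      _ ≤ Real.exp n := by
          gcongr
          rwa [hy, le_div_iff₀ hlog] at hmy
  have hterm : (m : ℝ) ^ n / m.factorial ≤ bell n * Real.exp 1 :=
    le_hasSum (hasSum_pow_div_factorial n) m fun k _ => by positivity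
  have hbell : (m : ℝ) ^ n ≤ bell n * Real.exp (n + 1) := by
    rw [div_le_iff₀ (by positivity)] at hterm
    calc (m : ℝ) ^ n ≤ bell n * Real.exp 1 * m.factorial := hterm
      _ ≤ bell n * Real.exp 1 * Real.exp n := by gcongr
      _ = bell n * Real.exp (n + 1) := by rw [Real.exp_add]; ring
  calc ((n : ℝ) / (6 * Real.log n)) ^ n = (y / 6) ^ n := by
        rw [hy]
        congr 1
        field_simp
    _ ≤ (m / 3 : ℝ) ^ n := by
        gcongr ?_ ^ n
        linarith
    _ = (m : ℝ) ^ n / 3 ^ n := div_pow _ _ _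
    _ ≤ bell n := by
        rw [div_le_iff₀ (by positivity)]
        exact hbell.trans (by gcongr; exact exp_succ_le_three_pow hn)

theorem stmt13 (n s : ℕ) (hn : 50 ≤ n) (hs1 : 1 ≤ s) (hs2 : s ≤ n - 2) :
    ((n : ℝ) / (6 * Real.log n)) ^ s * (bell (n - s) : ℝ) ≤ (bell n : ℝ) :=
  pow_mul_bell_le_of_pow_le_bell
    (div_nonneg n.cast_nonneg (mul_nonneg (by norm_num) (Real.log_natCast_nonneg n)))
    (by omega) (by omega) (pow_le_bell hn)
end

section
/- Let ℓ ≥ 2 and n be integers with n ≥ 1 + 2ℓ·log₂ n. Then the Stirling numbers of the second kind satisfy S(n,ℓ) ≥ n²·S(n−1, ℓ−1). -/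
open scoped Classical

/-- The Stirling number of the second kind `S(n,ℓ)`: the number of partitions of `[n]`
into exactly `ℓ` parts. -/
noncomputable def stirling (n ℓ : ℕ) : ℕ :=
  (Finset.univ.filter fun P : Finset (Finset (Fin n)) => IsPartition P ∧ P.card = ℓ).card

/-- The parts of a partition of `[n]` have total size `n`. -/
theorem IsPartition.sum_card {n : ℕ} {P : Finset (Finset (Fin n))} (hP : IsPartition P) :
    ∑ p ∈ P, p.card = n := by
  have h := Finset.card_biUnion (s := P) (t := id) fun p hp q hq hpq => hP.2.1 p hp q hq hpq
  have huniv : P.biUnion id = Finset.univ := by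
    ext x
    simpa using hP.2.2 x
  rw [huniv, Finset.card_univ, Fintype.card_fin] at h
  exact h.symm

/-- In a partition of `[n]` into `k + 1` parts, exactly `k` parts avoid a given element. -/
theorem IsPartition.card_filter_notMem {n k : ℕ} {P : Finset (Finset (Fin n))}
    (hP : IsPartition P) (hk : P.card = k + 1) (x : Fin n) :
    (P.filter (x ∉ ·)).card = k := by
  obtain ⟨p, hp, hx⟩ := hP.2.2 x
  have h : P.filter (x ∉ ·) = P.erase p := by
    ext q
    simp only [Finset.mem_filter, Finset.mem_erase]
    constructor
    · rintro ⟨hq, hxq⟩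
      exact ⟨fun h => hxq (h ▸ hx), hq⟩
    · rintro ⟨hne, hq⟩
      exact ⟨hq, fun hxq => Finset.disjoint_left.1 (hP.2.1 q hq p hp hne) hxq hx⟩
  rw [h, Finset.card_erase_of_mem hp, hk, Nat.add_sub_cancel]

/-- View a subset of `[m]` as a subset of `[m + 1]`. -/
def liftPart {m : ℕ} (s : Finset (Fin m)) : Finset (Fin (m + 1)) :=
  s.map Fin.castSuccEmb

theorem liftPart_injective {m : ℕ} : Function.Injective (liftPart (m := m)) :=
  Finset.map_injective _

theorem last_notMem_liftPart {m : ℕ} (s : Finset (Fin m)) : Fin.last m ∉ liftPart s := by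
  simp [liftPart, Fin.castSucc_ne_last]

@[simp]
theorem castSucc_mem_liftPart {m : ℕ} {s : Finset (Fin m)} {x : Fin m} :
    x.castSucc ∈ liftPart s ↔ x ∈ s := by
  simp [liftPart]

theorem disjoint_liftPart {m : ℕ} {s t : Finset (Fin m)} :
    Disjoint (liftPart s) (liftPart t) ↔ Disjoint s t :=
  Finset.disjoint_map _

/-- Split the part `p` of `Q` into `A` and `p \ A`, and adjoin the new last element to the
latter. -/
noncomputable def splitPart {m : ℕ} (Q : Finset (Finset (Fin m))) (p A : Finset (Fin m)) :
    Finset (Finset (Fin (m + 1))) :=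
  insert (liftPart A)
    (insert (insert (Fin.last m) (liftPart (p \ A))) ((Q.erase p).image liftPart))

section splitPart

variable {m : ℕ} {Q : Finset (Finset (Fin m))} {p A : Finset (Fin m)}

theorem mem_splitPart {X : Finset (Fin (m + 1))} :
    X ∈ splitPart Q p A ↔ X = liftPart A ∨ X = insert (Fin.last m) (liftPart (p \ A)) ∨
      ∃ q ∈ Q, q ≠ p ∧ liftPart q = X := by
  simp [splitPart, and_left_comm, and_assoc]

theorem liftPart_mem_splitPart {q : Finset (Fin m)} :
    liftPart q ∈ splitPart Q p A ↔ q = A ∨ q ∈ Q.erase p := by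
  have h : liftPart q ≠ insert (Fin.last m) (liftPart (p \ A)) := fun h =>
    last_notMem_liftPart q (h ▸ Finset.mem_insert_self _ _)
  simp [mem_splitPart, h, liftPart_injective.eq_iff, and_comm]

theorem insert_last_mem_splitPart {q : Finset (Fin m)} :
    insert (Fin.last m) (liftPart q) ∈ splitPart Q p A ↔ q = p \ A := by
  have h (r : Finset (Fin m)) : liftPart r ≠ insert (Fin.last m) (liftPart q) := fun h =>
    last_notMem_liftPart r (h ▸ Finset.mem_insert_self _ _)
  have h' : insert (Fin.last m) (liftPart q) = insert (Fin.last m) (liftPart (p \ A)) ↔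
      q = p \ A := by
    refine ⟨fun h => liftPart_injective ?_, fun h => h ▸ rfl⟩
    rw [← Finset.erase_insert (last_notMem_liftPart q), h,
      Finset.erase_insert (last_notMem_liftPart _)]
  simp [mem_splitPart, h, (h A).symm, h']

theorem IsPartition.notMem_erase (hQ : IsPartition Q) (hp : p ∈ Q) (hA : A.Nonempty)
    (hAp : A ⊆ p) : A ∉ Q.erase p := by
  intro h
  have hd := hQ.2.1 A (Finset.mem_of_mem_erase h) p hp (Finset.ne_of_mem_erase h)
  exact hA.ne_empty (Finset.disjoint_self_iff_empty _ |>.1 (hd.mono_right hAp))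

theorem IsPartition.isPartition_splitPart (hQ : IsPartition Q) (hp : p ∈ Q) (hA : A.Nonempty)
    (hAp : A ⊆ p) : IsPartition (splitPart Q p A) := by
  have hlast (q r : Finset (Fin m)) (h : Disjoint q r) :
      Disjoint (liftPart q) (insert (Fin.last m) (liftPart r)) :=
    Finset.disjoint_insert_right.2 ⟨last_notMem_liftPart q, disjoint_liftPart.2 h⟩
  refine ⟨fun h => ?_, ?_, fun x => ?_⟩
  · have h' : liftPart ∅ ∈ splitPart Q p A := h
    rcases liftPart_mem_splitPart.1 h' with h | h
    · exact hA.ne_empty h.symm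
    · exact hQ.1 (Finset.mem_of_mem_erase h)
  · intro X hX Y hY hXY
    rw [mem_splitPart] at hX hY
    rcases hX with rfl | rfl | ⟨q, hq, hqp, rfl⟩ <;> rcases hY with rfl | rfl | ⟨r, hr, hrp, rfl⟩
    · exact absurd rfl hXY
    · exact hlast _ _ Finset.disjoint_sdiff
    · exact disjoint_liftPart.2 ((hQ.2.1 p hp r hr hrp.symm).mono_left hAp)
    · exact (hlast _ _ Finset.disjoint_sdiff).symm
    · exact absurd rfl hXY
    · exact (hlast _ _ ((hQ.2.1 r hr p hp hrp).mono_right Finset.sdiff_subset)).symm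
    · exact disjoint_liftPart.2 ((hQ.2.1 q hq p hp hqp).mono_right hAp)
    · exact hlast _ _ ((hQ.2.1 q hq p hp hqp).mono_right Finset.sdiff_subset)
    · exact disjoint_liftPart.2 (hQ.2.1 q hq r hr fun h => hXY (h ▸ rfl))
  · induction x using Fin.lastCases with
    | last => exact ⟨_, insert_last_mem_splitPart.2 rfl, Finset.mem_insert_self _ _⟩
    | cast x =>
      obtain ⟨q, hq, hx⟩ := hQ.2.2 x
      by_cases hqp : q = p
      · subst hqp
        by_cases hxA : x ∈ A
        · exact ⟨_, liftPart_mem_splitPart.2 (Or.inl rfl), castSucc_mem_liftPart.2 hxA⟩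
        · exact ⟨_, insert_last_mem_splitPart.2 rfl, Finset.mem_insert_of_mem
            (castSucc_mem_liftPart.2 (Finset.mem_sdiff.2 ⟨hx, hxA⟩))⟩
      · exact ⟨_, liftPart_mem_splitPart.2 (Or.inr (Finset.mem_erase.2 ⟨hqp, hq⟩)),
          castSucc_mem_liftPart.2 hx⟩

theorem IsPartition.card_splitPart (hQ : IsPartition Q) (hp : p ∈ Q) (hA : A.Nonempty)
    (hAp : A ⊆ p) : (splitPart Q p A).card = Q.card + 1 := by
  have hlast (q r : Finset (Fin m)) : liftPart q ≠ insert (Fin.last m) (liftPart r) := fun h =>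
    last_notMem_liftPart q (h ▸ Finset.mem_insert_self _ _)
  have hA' := hQ.notMem_erase hp hA hAp
  rw [splitPart, Finset.card_insert_of_notMem, Finset.card_insert_of_notMem,
    Finset.card_image_of_injective _ liftPart_injective, Finset.card_erase_add_one hp]
  · simp [hlast]
  · simpa [hlast, liftPart_injective.eq_iff] using hA'

theorem IsPartition.splitPart_inj {Q' : Finset (Finset (Fin m))} {p' : Finset (Fin m)}
    (hQ : IsPartition Q) (hp : p ∈ Q) (hQ' : IsPartition Q') (hp' : p' ∈ Q') (hA : A.Nonempty)
    (hAp : A ⊆ p) (hAp' : A ⊆ p') (h : splitPart Q p A = splitPart Q' p' A) :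
    Q = Q' ∧ p = p' := by
  have hpp : p = p' := by
    have h1 := insert_last_mem_splitPart.1 (h ▸ insert_last_mem_splitPart.2 rfl :
      insert (Fin.last m) (liftPart (p \ A)) ∈ splitPart Q' p' A)
    rw [← Finset.sdiff_union_of_subset hAp, h1, Finset.sdiff_union_of_subset hAp']
  subst hpp
  refine ⟨?_, rfl⟩
  have hE : Q.erase p = Q'.erase p := by
    have hn := hQ.notMem_erase hp hA hAp
    have hn' := hQ'.notMem_erase hp' hA hAp
    ext q
    have hq := liftPart_mem_splitPart (Q := Q) (p := p) (A := A) (q := q)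
    rw [h, liftPart_mem_splitPart] at hq
    by_cases hqA : q = A
    · subst hqA
      exact iff_of_false hn hn'
    · simpa only [hqA, false_or] using hq.symm
  rw [← Finset.insert_erase hp, hE, Finset.insert_erase hp']

end splitPart

/-- Counting pairs of a partition of `[m + 1]` into `k + 1` parts and a part avoiding the last
element, by merging this part with the one containing the last element. -/
theorem sum_sum_two_pow_sub_one_le (m k : ℕ) :
    ∑ Q : Finset (Finset (Fin m)) with IsPartition Q ∧ Q.card = k, ∑ p ∈ Q, (2 ^ p.card - 1) ≤
      k * stirling (m + 1) (k + 1) := by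
  let S : Finset (Σ _ : Finset (Finset (Fin m)), Σ _ : Finset (Fin m), Finset (Fin m)) :=
    (Finset.univ.filter fun Q => IsPartition Q ∧ Q.card = k).sigma fun Q =>
      Q.sigma fun p => p.powerset.erase ∅
  let T : Finset (Σ _ : Finset (Finset (Fin (m + 1))), Finset (Fin (m + 1))) :=
    (Finset.univ.filter fun P => IsPartition P ∧ P.card = k + 1).sigma fun P =>
      P.filter (Fin.last m ∉ ·)
  have hS : S.card = ∑ Q : Finset (Finset (Fin m)) with IsPartition Q ∧ Q.card = k,
      ∑ p ∈ Q, (2 ^ p.card - 1) := by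
    simp [S, Finset.card_sigma, Finset.card_erase_of_mem, Finset.card_powerset]
  have hT : T.card = k * stirling (m + 1) (k + 1) := by
    rw [Finset.card_sigma, Finset.sum_const_nat (m := k), stirling, mul_comm]
    intro P hP
    obtain ⟨hP, hk⟩ := (Finset.mem_filter.1 hP).2
    exact hP.card_filter_notMem hk _
  have hmemS {Q : Finset (Finset (Fin m))} {p A : Finset (Fin m)} (h : ⟨Q, p, A⟩ ∈ S) :
      IsPartition Q ∧ Q.card = k ∧ p ∈ Q ∧ A.Nonempty ∧ A ⊆ p := by
    simpa [S, and_assoc, Finset.nonempty_iff_ne_empty] using h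
  rw [← hS, ← hT]
  refine Finset.card_le_card_of_injOn
    (fun x => ⟨splitPart x.1 x.2.1 x.2.2, liftPart x.2.2⟩) ?_ ?_
  · rintro ⟨Q, p, A⟩ h
    obtain ⟨hQ, hk, hp, hA, hAp⟩ := hmemS h
    have hcard := hQ.card_splitPart hp hA hAp
    have hmem := liftPart_mem_splitPart (Q := Q) (p := p).2 (Or.inl (Eq.refl A))
    simp [T, hQ.isPartition_splitPart hp hA hAp, hcard, hk, hmem, last_notMem_liftPart]
  · rintro ⟨Q, p, A⟩ h ⟨Q', p', A'⟩ h' heq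
    obtain ⟨hQ, -, hp, hA, hAp⟩ := hmemS h
    obtain ⟨hQ', -, hp', -, hAp'⟩ := hmemS h'
    simp only [Sigma.mk.injEq, heq_eq_eq] at heq
    obtain ⟨hsplit, hlift⟩ := heq
    obtain rfl := liftPart_injective hlift
    obtain ⟨rfl, rfl⟩ := hQ.splitPart_inj hp hQ' hp' hA hAp hAp' hsplit
    rfl

/-- A form of Jensen's inequality for `2 ^ x`. -/
theorem card_mul_le_sum_two_pow {ι : Type*} (s : Finset ι) (f : ι → ℕ) {c : ℝ} (hc : 0 < c)
    (h : s.card * Real.log c ≤ Real.log 2 * (∑ i ∈ s, f i : ℕ)) :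
    s.card * c ≤ ∑ i ∈ s, (2 : ℝ) ^ f i := by
  have hterm (i : ι) : c + c * (Real.log 2 * f i - Real.log c) ≤ (2 : ℝ) ^ f i := by
    have h1 := Real.add_one_le_exp (Real.log 2 * f i - Real.log c)
    rw [Real.exp_sub, Real.exp_log hc, mul_comm (Real.log 2), Real.exp_nat_mul,
      Real.exp_log two_pos, le_div_iff₀ hc] at h1
    linarith
  have hsum := Finset.sum_le_sum fun i (_ : i ∈ s) => hterm i
  rw [Finset.sum_add_distrib, ← Finset.mul_sum, Finset.sum_sub_distrib, ← Finset.mul_sum,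
    Finset.sum_const, Finset.sum_const, nsmul_eq_mul, nsmul_eq_mul] at hsum
  push_cast at h
  nlinarith [mul_nonneg hc.le (sub_nonneg.2 h)]

theorem mul_log_sq_add_one_le {n ℓ : ℕ} (hn2 : 2 ≤ n)
    (hn : 1 + 2 * (ℓ : ℝ) * Real.logb 2 n ≤ (n : ℝ)) :
    ((ℓ : ℝ) - 1) * Real.log ((n : ℝ) ^ 2 + 1) ≤ Real.log 2 * (n - 1) := by
  have hn2' : (2 : ℝ) ≤ n := by exact_mod_cast hn2
  have hlog2 : 0.6931471803 < Real.log 2 := Real.log_two_gt_d9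
  have hlogn : Real.log 2 ≤ Real.log n := Real.log_le_log two_pos hn2'
  have hmain : 2 * (ℓ : ℝ) * Real.log n ≤ Real.log 2 * (n - 1) := by
    have h : Real.logb 2 n * Real.log 2 = Real.log n := by
      rw [Real.logb, div_mul_cancel₀]
      positivity
    rw [← h]
    nlinarith
  rcases Nat.eq_zero_or_pos ℓ with rfl | hpos
  · have h1 : 0 ≤ Real.log ((n : ℝ) ^ 2 + 1) := Real.log_nonneg (by nlinarith)
    push_cast at *
    nlinarith
  have hpos' : (1 : ℝ) ≤ ℓ := by exact_mod_cast hpos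
  have hℓn : 2 * (ℓ : ℝ) ≤ n := by
    nlinarith
  have hsq : Real.log ((n : ℝ) ^ 2 + 1) ≤ 2 * Real.log n + 1 / (n : ℝ) ^ 2 := by
    have h1 : (n : ℝ) ^ 2 + 1 = (n : ℝ) ^ 2 * (1 + 1 / (n : ℝ) ^ 2) := by
      field_simp
    have h2 := Real.log_le_sub_one_of_pos (x := 1 + 1 / (n : ℝ) ^ 2) (by positivity)
    rw [h1, Real.log_mul (by positivity) (by positivity), Real.log_pow]
    push_cast
    linarith
  have hsmall : ((ℓ : ℝ) - 1) * (1 / (n : ℝ) ^ 2) ≤ 1 := by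
    rw [mul_one_div, div_le_one (by positivity)]
    nlinarith
  nlinarith [mul_le_mul_of_nonneg_left hsq (sub_nonneg.2 hpos')]

theorem stirling_zero_left {k : ℕ} (hk : k ≠ 0) : stirling 0 k = 0 := by
  rw [stirling, Finset.card_eq_zero, Finset.filter_eq_empty_iff]
  rintro P - ⟨hP, hcard⟩
  obtain ⟨p, hp⟩ := Finset.card_pos.1 (hcard ▸ Nat.pos_of_ne_zero hk)
  exact hP.1 (Subsingleton.elim p ∅ ▸ hp)

theorem stmt14 (n ℓ : ℕ) (hℓ : 2 ≤ ℓ)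
    (hn : 1 + 2 * (ℓ : ℝ) * Real.logb 2 n ≤ (n : ℝ)) :
    n ^ 2 * stirling (n - 1) (ℓ - 1) ≤ stirling n ℓ := by
  rcases Nat.lt_or_ge n 2 with hlt | hn2
  · rw [show n - 1 = 0 by omega, stirling_zero_left (by omega), mul_zero]
    exact Nat.zero_le _
  have hlog := mul_log_sq_add_one_le hn2 hn
  obtain ⟨m, rfl⟩ : ∃ m, n = m + 1 := ⟨n - 1, by omega⟩
  obtain ⟨k, rfl⟩ : ∃ k, ℓ = k + 1 := ⟨ℓ - 1, by omega⟩
  simp only [Nat.add_sub_cancel]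
  refine Nat.le_of_mul_le_mul_left (le_trans ?_ (sum_sum_two_pow_sub_one_le m k))
    (by omega : 0 < k)
  rw [← mul_assoc, mul_comm, stirling, ← smul_eq_mul]
  refine Finset.card_nsmul_le_sum _ _ _ fun Q hQ => ?_
  obtain ⟨hQ, hk⟩ := (Finset.mem_filter.1 hQ).2
  have hJ := card_mul_le_sum_two_pow Q Finset.card
    (c := ((m + 1 : ℕ) : ℝ) ^ 2 + 1) (by positivity) (by
      rw [hQ.sum_card, hk]
      push_cast at hlog ⊢
      simpa using hlog)
  have hsub : ∑ p ∈ Q, (2 ^ p.card - 1) + k = ∑ p ∈ Q, 2 ^ p.card := by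
    rw [← hk, Finset.card_eq_sum_ones, ← Finset.sum_add_distrib]
    exact Finset.sum_congr rfl fun p _ => Nat.sub_add_cancel Nat.one_le_two_pow
  have hJ' : k * ((m + 1) ^ 2 + 1) ≤ ∑ p ∈ Q, 2 ^ p.card := by
    rw [hk] at hJ
    exact_mod_cast hJ
  rw [← hsub, mul_add, mul_one] at hJ'
  exact Nat.le_of_add_le_add_right hJ'
end

section
/- Let k ≥ t ≥ 2 be integers with k ≥ 3. There exists ℓ₀ depending only on k such that for every integer ℓ ≥ ℓ₀ the following holds. Let T ⊆ [kℓ] be a set of size t and let Y be a (k,ℓ)-partition none of whose parts contains T (i.e., Y ∉ 𝓒_{k,ℓ}^T). Then the number of (k,ℓ)-partitions Z ∈ 𝓒_{k,ℓ}^T such that Z and Y do not partially t-intersect is at least ℓ^{−2k²}·u_{k,ℓ}. -/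
open scoped Classical

/-- A `(k,ℓ)`-partition: a partition of `[kℓ]` into exactly `ℓ` parts, each of size `k`. -/
def IsKLPartition (k ℓ : ℕ) (P : Finset (Finset (Fin (k * ℓ)))) : Prop :=
  IsPartition P ∧ P.card = ℓ ∧ ∀ p ∈ P, p.card = k

/-- `u_{k,ℓ}`: the number of `(k,ℓ)`-partitions. -/
noncomputable def uKL (k ℓ : ℕ) : ℕ :=
  (Finset.univ.filter fun P : Finset (Finset (Fin (k * ℓ))) => IsKLPartition k ℓ P).card

open scoped Pointwise

/-- `x` and `y` lie in a common part of `P`. -/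
def SameBlock {n : ℕ} (P : Finset (Finset (Fin n))) (x y : Fin n) : Prop :=
  ∃ p ∈ P, x ∈ p ∧ y ∈ p

/-- The `(k,ℓ)`-partitions having a part that contains `T`. -/
noncomputable def klContaining (k ℓ : ℕ) (T : Finset (Fin (k * ℓ))) :
    Finset (Finset (Finset (Fin (k * ℓ)))) :=
  Finset.univ.filter fun Z => IsKLPartition k ℓ Z ∧ ∃ p ∈ Z, T ⊆ p

/-- The elements outside `T` which share a part of `Y` and a part of `Z` with some
other element. -/
noncomputable def conflicts {n : ℕ} (T : Finset (Fin n)) (Y Z : Finset (Finset (Fin n))) :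
    Finset (Fin n) :=
  Finset.univ.filter fun y => y ∉ T ∧ ∃ x, x ≠ y ∧ SameBlock Y x y ∧ SameBlock Z x y

lemma SameBlock.symm {n : ℕ} {P : Finset (Finset (Fin n))} {x y : Fin n}
    (h : SameBlock P x y) : SameBlock P y x := by
  obtain ⟨p, hp, hx, hy⟩ := h
  exact ⟨p, hp, hy, hx⟩

lemma sameBlock_smul {n : ℕ} (σ : Equiv.Perm (Fin n)) (P : Finset (Finset (Fin n)))
    (x y : Fin n) : SameBlock (σ • P) x y ↔ SameBlock P (σ⁻¹ x) (σ⁻¹ y) := by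
  constructor
  · rintro ⟨p, hp, hx, hy⟩
    obtain ⟨q, hq, rfl⟩ := Finset.mem_smul_finset.1 hp
    exact ⟨q, hq, Finset.inv_smul_mem_iff.2 hx, Finset.inv_smul_mem_iff.2 hy⟩
  · rintro ⟨q, hq, hx, hy⟩
    exact ⟨σ • q, Finset.smul_mem_smul_finset hq, Finset.inv_smul_mem_iff.1 hx,
      Finset.inv_smul_mem_iff.1 hy⟩

lemma IsKLPartition.smul {k ℓ : ℕ} {P : Finset (Finset (Fin (k * ℓ)))}
    (h : IsKLPartition k ℓ P) (σ : Equiv.Perm (Fin (k * ℓ))) : IsKLPartition k ℓ (σ • P) := by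
  obtain ⟨⟨h0, hd, hc⟩, hl, hk⟩ := h
  refine ⟨⟨?_, ?_, ?_⟩, ?_, ?_⟩
  · intro h
    obtain ⟨q, hq, hq'⟩ := Finset.mem_smul_finset.1 h
    rw [Finset.smul_finset_eq_empty] at hq'
    exact h0 (hq' ▸ hq)
  · intro _ hp' _ hq' hpq
    obtain ⟨p, hp, rfl⟩ := Finset.mem_smul_finset.1 hp'
    obtain ⟨q, hq, rfl⟩ := Finset.mem_smul_finset.1 hq'
    have := hd p hp q hq (fun h => hpq (by rw [h]))
    rw [Finset.disjoint_left] at this ⊢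
    intro x hx hx'
    exact this (Finset.inv_smul_mem_iff.2 hx) (Finset.inv_smul_mem_iff.2 hx')
  · intro x
    obtain ⟨p, hp, hx⟩ := hc (σ⁻¹ • x)
    exact ⟨σ • p, Finset.smul_mem_smul_finset hp, Finset.inv_smul_mem_iff.1 hx⟩
  · rw [Finset.card_smul_finset, hl]
  · intro _ hp'
    obtain ⟨p, hp, rfl⟩ := Finset.mem_smul_finset.1 hp'
    rw [Finset.card_smul_finset, hk p hp]

lemma IsKLPartition.card_sameBlock {k ℓ : ℕ} {P : Finset (Finset (Fin (k * ℓ)))}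
    (h : IsKLPartition k ℓ P) (x : Fin (k * ℓ)) :
    (Finset.univ.filter fun y => SameBlock P x y).card = k := by
  obtain ⟨⟨-, hd, hc⟩, -, hk⟩ := h
  obtain ⟨p, hp, hx⟩ := hc x
  refine Eq.trans (congrArg Finset.card ?_) (hk p hp)
  ext y
  simp only [Finset.mem_filter, Finset.mem_univ, true_and]
  refine ⟨?_, fun hy => ⟨p, hp, hx, hy⟩⟩
  rintro ⟨q, hq, hxq, hyq⟩
  by_cases hpq : p = q
  · rwa [hpq]
  · exact absurd hxq (Finset.disjoint_left.1 (hd p hp q hq hpq) hx)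

lemma IsKLPartition.card_sameBlock_erase {k ℓ : ℕ} {P : Finset (Finset (Fin (k * ℓ)))}
    (h : IsKLPartition k ℓ P) (x : Fin (k * ℓ)) :
    (Finset.univ.filter fun y => y ≠ x ∧ SameBlock P x y).card = k - 1 := by
  have hx : x ∈ Finset.univ.filter fun y => SameBlock P x y := by
    obtain ⟨p, hp, hx⟩ := h.1.2.2 x
    simpa using ⟨p, hp, hx, hx⟩
  refine Eq.trans (congrArg Finset.card ?_)
    ((Finset.card_erase_of_mem hx).trans (congrArg (· - 1) (h.card_sameBlock x)))
  ext y
  simp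

/-- If each element of `A` is moved into `B` by one of the `g i`, then `A` is at most
`card ι` times larger than `B`. -/
lemma card_le_card_mul_of_exists_smul_mem {G X ι : Type*} [Group G] [MulAction G X]
    [Fintype ι] (g : ι → G) {A B : Finset X} (h : ∀ a ∈ A, ∃ i, g i • a ∈ B) :
    A.card ≤ Fintype.card ι * B.card := by
  have hsub : A ⊆ Finset.univ.biUnion fun i => B.image fun b => (g i)⁻¹ • b := by
    intro a ha
    obtain ⟨i, hi⟩ := h a ha
    simp only [Finset.mem_biUnion, Finset.mem_univ, true_and, Finset.mem_image]
    exact ⟨i, _, hi, inv_smul_smul _ _⟩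
  exact (Finset.card_le_card hsub).trans
    (Finset.card_biUnion_le_card_mul _ _ _ fun i _ => Finset.card_image_le)

lemma subset_swap_smul {n : ℕ} {S p : Finset (Fin n)} {a b : Fin n} (h : S ⊆ p)
    (ha : a ∉ S) (hb : b ∉ S) : S ⊆ Equiv.swap a b • p := by
  intro s hs
  rw [← Finset.inv_smul_mem_iff, Equiv.swap_inv, Equiv.Perm.smul_def,
    Equiv.swap_apply_of_ne_of_ne (by grind) (by grind)]
  exact h hs

lemma swap_smul_mem_klContaining {k ℓ : ℕ} {T : Finset (Fin (k * ℓ))} {a b : Fin (k * ℓ)}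
    {Z : Finset (Finset (Fin (k * ℓ)))} (hZ : Z ∈ klContaining k ℓ T)
    (ha : a ∉ T) (hb : b ∉ T) : Equiv.swap a b • Z ∈ klContaining k ℓ T := by
  simp only [klContaining, Finset.mem_filter, Finset.mem_univ, true_and] at hZ ⊢
  obtain ⟨h, p, hp, hT⟩ := hZ
  exact ⟨h.smul _, _, Finset.smul_mem_smul_finset hp, subset_swap_smul hT ha hb⟩

lemma card_klContaining_le_insert {k ℓ : ℕ} {S : Finset (Fin (k * ℓ))} {b : Fin (k * ℓ)}
    (hb : b ∉ S) (hS : S.card < k) :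
    (klContaining k ℓ S).card ≤ (k * ℓ) * (klContaining k ℓ (insert b S)).card := by
  have := card_le_card_mul_of_exists_smul_mem (fun w => Equiv.swap b w)
    (A := klContaining k ℓ S) (B := klContaining k ℓ (insert b S)) ?_
  · simpa using this
  intro Z hZ
  simp only [klContaining, Finset.mem_filter, Finset.mem_univ, true_and] at hZ ⊢
  obtain ⟨h, p, hp, hSp⟩ := hZ
  obtain ⟨w, hw, hwS⟩ := Finset.exists_mem_notMem_of_card_lt_card (hS.trans_eq (h.2.2 p hp).symm)
  refine ⟨w, h.smul _, _, Finset.smul_mem_smul_finset hp, ?_⟩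
  refine Finset.insert_subset ?_ (subset_swap_smul hSp hb hwS)
  rw [← Finset.inv_smul_mem_iff, Equiv.swap_inv, Equiv.Perm.smul_def, Equiv.swap_apply_left]
  exact hw

lemma uKL_le_card_klContaining {k ℓ : ℕ} (hn : 0 < k * ℓ) (T : Finset (Fin (k * ℓ)))
    (hT : T.card ≤ k) : uKL k ℓ ≤ (k * ℓ) ^ T.card * (klContaining k ℓ T).card := by
  induction T using Finset.induction_on with
  | empty =>
    simp only [Finset.card_empty, pow_zero, one_mul]
    refine Finset.card_le_card fun Z hZ => ?_
    simp only [klContaining, Finset.mem_filter, Finset.mem_univ, true_and] at hZ ⊢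
    obtain ⟨p, hp, -⟩ := hZ.1.2.2 ⟨0, hn⟩
    exact ⟨hZ, p, hp, Finset.empty_subset p⟩
  | insert b S hb ih =>
    rw [Finset.card_insert_of_notMem hb] at hT ⊢
    calc uKL k ℓ ≤ (k * ℓ) ^ S.card * (klContaining k ℓ S).card := ih (by omega)
      _ ≤ (k * ℓ) ^ S.card * ((k * ℓ) * (klContaining k ℓ (insert b S)).card) :=
        Nat.mul_le_mul_left _ (card_klContaining_le_insert hb (by omega))
      _ = _ := by ring

/-- By symmetry, a fixed pair not inside `T` shares a part with probability at most about
`1 / ℓ`. -/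
lemma mul_card_filter_sameBlock_le {k ℓ : ℕ} {T : Finset (Fin (k * ℓ))} {x y : Fin (k * ℓ)}
    (hxy : x ≠ y) (hy : y ∉ T) :
    (k * ℓ - (T.card + 1)) * ((klContaining k ℓ T).filter fun Z => SameBlock Z x y).card ≤
      (k - 1) * (klContaining k ℓ T).card := by
  set A := klContaining k ℓ T
  have hsymm : ∀ z ∈ (insert x T)ᶜ,
      (A.filter fun Z => SameBlock Z x y).card ≤ (A.filter fun Z => SameBlock Z x z).card := by
    intro z hz
    simp only [Finset.mem_compl, Finset.mem_insert, not_or] at hz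
    refine Finset.card_le_card_of_injOn (fun Z => Equiv.swap y z • Z) ?_
      (MulAction.injective _).injOn
    intro Z hZ
    simp only [Finset.coe_filter, Set.mem_ofPred_eq] at hZ ⊢
    refine ⟨swap_smul_mem_klContaining hZ.1 hy hz.2, ?_⟩
    rw [sameBlock_smul, Equiv.swap_inv, Equiv.swap_apply_right,
      Equiv.swap_apply_of_ne_of_ne hxy (Ne.symm hz.1)]
    exact hZ.2
  have hcard : k * ℓ - (T.card + 1) ≤ (insert x T)ᶜ.card := by
    rw [Finset.card_compl, Fintype.card_fin]
    exact Nat.sub_le_sub_left (Finset.card_insert_le _ _) _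
  calc (k * ℓ - (T.card + 1)) * (A.filter fun Z => SameBlock Z x y).card
      ≤ (insert x T)ᶜ.card * (A.filter fun Z => SameBlock Z x y).card :=
        Nat.mul_le_mul_right _ hcard
    _ ≤ ∑ z ∈ (insert x T)ᶜ, (A.filter fun Z => SameBlock Z x z).card := by
        simpa using Finset.card_nsmul_le_sum _ _ _ hsymm
    _ = ∑ Z ∈ A, ((insert x T)ᶜ.filter fun z => SameBlock Z x z).card :=
        Finset.sum_card_bipartiteAbove_eq_sum_card_bipartiteBelow fun z Z => SameBlock Z x z
    _ ≤ ∑ Z ∈ A, (k - 1) := by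
        refine Finset.sum_le_sum fun Z hZ => ?_
        rw [← (Finset.mem_filter.1 hZ).2.1.card_sameBlock_erase x]
        refine Finset.card_le_card fun z hz => ?_
        simp only [Finset.mem_filter, Finset.mem_compl, Finset.mem_insert, not_or,
          Finset.mem_univ, true_and] at hz ⊢
        exact ⟨hz.1.1, hz.2⟩
    _ = (k - 1) * A.card := by rw [Finset.sum_const, smul_eq_mul, mul_comm]

lemma mul_sum_card_conflicts_le {k ℓ : ℕ} (T : Finset (Fin (k * ℓ)))
    {Y : Finset (Finset (Fin (k * ℓ)))} (hY : IsKLPartition k ℓ Y) :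
    (k * ℓ - (T.card + 1)) * ∑ Z ∈ klContaining k ℓ T, (conflicts T Y Z).card ≤
      (k * ℓ) * ((k - 1) * ((k - 1) * (klContaining k ℓ T).card)) := by
  set A := klContaining k ℓ T
  have hsum : ∑ Z ∈ A, (conflicts T Y Z).card ≤
      ∑ y ∈ Tᶜ, ∑ x ∈ Finset.univ.filter (fun x => x ≠ y ∧ SameBlock Y y x),
        (A.filter fun Z => SameBlock Z x y).card := by
    have hswap : ∑ Z ∈ A, (conflicts T Y Z).card =
        ∑ y ∈ Tᶜ, (A.filter fun Z => y ∈ conflicts T Y Z).card := by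
      refine Eq.trans ?_ (Finset.sum_card_bipartiteAbove_eq_sum_card_bipartiteBelow
        fun Z y => y ∈ conflicts T Y Z)
      refine Finset.sum_congr rfl fun Z _ => ?_
      congr 1
      ext y
      simp only [Finset.bipartiteAbove, Finset.mem_filter, Finset.mem_compl, conflicts,
        Finset.mem_univ, true_and]
      tauto
    rw [hswap]
    refine Finset.sum_le_sum fun y _ => (Finset.card_le_card ?_).trans Finset.card_biUnion_le
    intro Z hZ
    simp only [Finset.mem_filter, conflicts, Finset.mem_univ, true_and,
      Finset.mem_biUnion] at hZ ⊢
    obtain ⟨hZA, -, x, hxy, hxY, hxZ⟩ := hZ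
    exact ⟨x, ⟨hxy, hxY.symm⟩, hZA, hxZ⟩
  refine (Nat.mul_le_mul_left _ hsum).trans ?_
  rw [Finset.mul_sum]
  calc _ ≤ ∑ y ∈ Tᶜ, (k - 1) * ((k - 1) * A.card) := by
        refine Finset.sum_le_sum fun y hy => ?_
        rw [Finset.mul_sum]
        refine (Finset.sum_le_card_nsmul _ _ _ fun x hx => mul_card_filter_sameBlock_le
          (Finset.mem_filter.1 hx).2.1 (Finset.mem_compl.1 hy)).trans_eq ?_
        rw [hY.card_sameBlock_erase y, smul_eq_mul]
    _ ≤ _ := by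
        rw [Finset.sum_const, smul_eq_mul]
        exact Nat.mul_le_mul_right _ ((Finset.card_le_univ _).trans_eq (Fintype.card_fin _))

/-- A positive proportion of the partitions having `T` inside a part has few conflicts. -/
lemma card_klContaining_le_mul_card_few_conflicts {k ℓ : ℕ} (hk : 2 ≤ k)
    (hℓ : k + 1 ≤ ℓ) {T : Finset (Fin (k * ℓ))} (hT : T.card ≤ k)
    {Y : Finset (Finset (Fin (k * ℓ)))} (hY : IsKLPartition k ℓ Y) :
    (klContaining k ℓ T).card ≤ (k * (k - 1) + 1) *
      ((klContaining k ℓ T).filter fun Z => (conflicts T Y Z).card ≤ k * (k - 1)).card := by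
  set A := klContaining k ℓ T
  set M := k * (k - 1) with hM
  have hmean : ∑ Z ∈ A, (conflicts T Y Z).card ≤ M * A.card := by
    have h := mul_sum_card_conflicts_le T hY
    have hpos : 0 < k * ℓ - (T.card + 1) := by
      have : k * (k + 1) ≤ k * ℓ := Nat.mul_le_mul_left _ hℓ
      have : k + 1 < k * (k + 1) := by nlinarith
      omega
    refine Nat.le_of_mul_le_mul_left (h.trans ?_) hpos
    have hn : k * ℓ * (k - 1) ≤ (k * ℓ - (T.card + 1)) * k := by
      have h1 : k * (k + 1) ≤ k * ℓ := Nat.mul_le_mul_left _ hℓ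
      rw [Nat.mul_sub, Nat.sub_mul]
      have : (T.card + 1) * k ≤ k * ℓ * 1 := by nlinarith
      omega
    calc k * ℓ * ((k - 1) * ((k - 1) * A.card))
        = (k * ℓ * (k - 1)) * ((k - 1) * A.card) := by ring
      _ ≤ ((k * ℓ - (T.card + 1)) * k) * ((k - 1) * A.card) := Nat.mul_le_mul_right _ hn
      _ = _ := by rw [hM]; ring
  have hmarkov : (M + 1) * (A.filter fun Z => ¬ (conflicts T Y Z).card ≤ M).card ≤
      ∑ Z ∈ A, (conflicts T Y Z).card := by
    rw [mul_comm, ← smul_eq_mul]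
    refine (Finset.card_nsmul_le_sum _ (fun Z => (conflicts T Y Z).card) _ ?_).trans
      (Finset.sum_le_sum_of_subset (Finset.filter_subset _ _))
    intro Z hZ
    have := (Finset.mem_filter.1 hZ).2
    omega
  have hsplit := Finset.card_filter_add_card_filter_not (s := A)
    (fun Z => (conflicts T Y Z).card ≤ M)
  nlinarith

/-- A suitable transposition outside `T` removes a conflict and creates none. -/
lemma exists_swap_card_conflicts_lt {k ℓ : ℕ} {T : Finset (Fin (k * ℓ))}
    (hT : T.card + (k * k + k * k) < k * ℓ) {Y Z : Finset (Finset (Fin (k * ℓ)))}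
    (hY : IsKLPartition k ℓ Y) (hZ : IsKLPartition k ℓ Z) (h : (conflicts T Y Z).Nonempty) :
    ∃ y v, y ∉ T ∧ v ∉ T ∧
      (conflicts T Y (Equiv.swap y v • Z)).card < (conflicts T Y Z).card := by
  obtain ⟨y, hy⟩ := h
  have hyT : y ∉ T := (Finset.mem_filter.1 hy).2.1
  let B (P : Finset (Finset (Fin (k * ℓ)))) (x : Fin (k * ℓ)) :=
    Finset.univ.filter fun z => SameBlock P x z
  have hB : ∀ P Q, IsKLPartition k ℓ P → IsKLPartition k ℓ Q →
      ((B P y).biUnion (B Q)).card ≤ k * k := by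
    intro P Q hP hQ
    refine (Finset.card_biUnion_le_card_mul _ _ k fun x _ => (hQ.card_sameBlock x).le).trans ?_
    rw [hP.card_sameBlock y]
  obtain ⟨v, hv⟩ : ∃ v, v ∉ T ∪ ((B Y y).biUnion (B Z) ∪ (B Z y).biUnion (B Y)) := by
    by_contra! hall
    have h1 := Finset.card_le_card (fun v _ => hall v : Finset.univ ⊆ _)
    rw [Finset.card_univ, Fintype.card_fin] at h1
    have h2 := Finset.card_union_le T ((B Y y).biUnion (B Z) ∪ (B Z y).biUnion (B Y))
    have h3 := Finset.card_union_le ((B Y y).biUnion (B Z)) ((B Z y).biUnion (B Y))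
    have h4 := hB Y Z hY hZ
    have h5 := hB Z Y hZ hY
    omega
  simp only [Finset.mem_union, Finset.mem_biUnion, B, Finset.mem_filter, Finset.mem_univ,
    true_and, not_or, not_exists, not_and] at hv
  obtain ⟨hvT, hvZ, hvY⟩ := hv
  have hyy : SameBlock Z y y := by
    obtain ⟨p, hp, hyp⟩ := hZ.1.2.2 y
    exact ⟨p, hp, hyp, hyp⟩
  have key : ∀ a b, a ≠ b → SameBlock Y a b → SameBlock (Equiv.swap y v • Z) a b →
      a ≠ y ∧ a ≠ v := by
    intro a b hab haY haZ
    rw [sameBlock_smul, Equiv.swap_inv] at haZ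
    refine ⟨?_, ?_⟩
    · rintro rfl
      rw [Equiv.swap_apply_left] at haZ
      by_cases hbv : b = v
      · exact hvY a hyy (hbv ▸ haY)
      · rw [Equiv.swap_apply_of_ne_of_ne hab.symm hbv] at haZ
        exact hvZ b haY haZ.symm
    · rintro rfl
      rw [Equiv.swap_apply_right] at haZ
      by_cases hby : b = y
      · exact hvY y hyy (hby ▸ haY.symm)
      · rw [Equiv.swap_apply_of_ne_of_ne hby hab.symm] at haZ
        exact hvY b haZ haY.symm
  refine ⟨y, v, hyT, hvT, Finset.card_lt_card ?_⟩
  rw [Finset.ssubset_iff_of_subset]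
  · refine ⟨y, hy, fun hy' => ?_⟩
    obtain ⟨-, x, hxy, hxY, hxZ⟩ := (Finset.mem_filter.1 hy').2
    exact (key y x hxy.symm hxY.symm hxZ.symm).1 rfl
  · intro z hz
    obtain ⟨hzT, x, hxz, hxY, hxZ⟩ := (Finset.mem_filter.1 hz).2
    obtain ⟨hzy, hzv⟩ := key z x hxz.symm hxY.symm hxZ.symm
    obtain ⟨hxy, hxv⟩ := key x z hxz hxY hxZ
    rw [sameBlock_smul, Equiv.swap_inv, Equiv.swap_apply_of_ne_of_ne hxy hxv,
      Equiv.swap_apply_of_ne_of_ne hzy hzv] at hxZ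
    exact Finset.mem_filter.2 ⟨Finset.mem_univ _, hzT, x, hxz, hxY, hxZ⟩

lemma card_few_conflicts_le {k ℓ : ℕ} {T : Finset (Fin (k * ℓ))}
    (hT : T.card + (k * k + k * k) < k * ℓ) {Y : Finset (Finset (Fin (k * ℓ)))}
    (hY : IsKLPartition k ℓ Y) (m : ℕ) :
    ((klContaining k ℓ T).filter fun Z => (conflicts T Y Z).card ≤ m).card ≤
      (k * ℓ) ^ (2 * m) *
        ((klContaining k ℓ T).filter fun Z => conflicts T Y Z = ∅).card := by
  induction m with
  | zero => simp
  | succ m ih =>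
    have hstep := card_le_card_mul_of_exists_smul_mem
      (fun e : Fin (k * ℓ) × Fin (k * ℓ) => Equiv.swap e.1 e.2)
      (A := (klContaining k ℓ T).filter fun Z => (conflicts T Y Z).card ≤ m + 1)
      (B := (klContaining k ℓ T).filter fun Z => (conflicts T Y Z).card ≤ m) ?_
    · rw [Fintype.card_prod, Fintype.card_fin] at hstep
      calc _ ≤ _ := hstep
        _ ≤ _ := Nat.mul_le_mul_left _ ih
        _ = _ := by ring
    intro Z hZ
    obtain ⟨hZA, hZm⟩ := Finset.mem_filter.1 hZ
    rcases (conflicts T Y Z).eq_empty_or_nonempty with h0 | hne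
    · refine ⟨(⟨0, by omega⟩, ⟨0, by omega⟩), ?_⟩
      rw [Equiv.swap_self, ← Equiv.Perm.one_def, one_smul]
      exact Finset.mem_filter.2 ⟨hZA, by simp [h0]⟩
    · obtain ⟨y, v, hy, hv, hlt⟩ :=
        exists_swap_card_conflicts_lt hT hY (Finset.mem_filter.1 hZA).2.1 hne
      exact ⟨(y, v), Finset.mem_filter.2 ⟨swap_smul_mem_klContaining hZA hy hv,
        Nat.le_of_lt_succ (hlt.trans_le hZm)⟩⟩

/-- If every pair violating transversality lies inside `T`, then no part of `Z` meets a part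
of `Y` in `T.card` elements. -/
lemma not_partially_intersect_of_conflicts_eq_empty {n : ℕ} {T : Finset (Fin n)}
    (hT : 2 ≤ T.card) {Y Z : Finset (Finset (Fin n))} (hTY : ¬∃ p ∈ Y, T ⊆ p)
    (h : conflicts T Y Z = ∅) : ¬∃ p ∈ Z, ∃ q ∈ Y, T.card ≤ (p ∩ q).card := by
  rintro ⟨p, hp, q, hq, hpq⟩
  have hsub : p ∩ q ⊆ T := by
    intro y hy
    by_contra hyT
    obtain ⟨x, hx, hxy⟩ := Finset.exists_mem_ne (s := p ∩ q) (by omega) y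
    rw [Finset.mem_inter] at hx hy
    have : y ∈ conflicts T Y Z := Finset.mem_filter.2
      ⟨Finset.mem_univ _, hyT, x, hxy, ⟨q, hq, hx.2, hy.2⟩, ⟨p, hp, hx.1, hy.1⟩⟩
    simp [h] at this
  have heq := Finset.eq_of_subset_of_card_le hsub hpq
  exact hTY ⟨q, hq, heq ▸ Finset.inter_subset_right⟩

theorem stmt15 (k t : ℕ) (ht : 2 ≤ t) (htk : t ≤ k) (hk : 3 ≤ k) :
    ∃ ℓ₀ : ℕ, ∀ ℓ : ℕ, ℓ₀ ≤ ℓ →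
      ∀ T : Finset (Fin (k * ℓ)), T.card = t →
        ∀ Y : Finset (Finset (Fin (k * ℓ))), IsKLPartition k ℓ Y →
          (¬∃ p ∈ Y, T ⊆ p) →
          ((ℓ : ℝ) ^ (2 * k ^ 2))⁻¹ * (uKL k ℓ : ℝ) ≤
            (((Finset.univ.filter fun Z : Finset (Finset (Fin (k * ℓ))) =>
              IsKLPartition k ℓ Z ∧ (∃ p ∈ Z, T ⊆ p) ∧
                ¬∃ p ∈ Z, ∃ q ∈ Y, t ≤ (p ∩ q).card).card : ℝ)) := by
  refine ⟨k ^ (2 * k ^ 2 + 2), fun ℓ hℓ T hTt Y hY hTY => ?_⟩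
  have hℓ2 : k ^ 2 ≤ ℓ := (Nat.pow_le_pow_right (by omega) (by omega)).trans hℓ
  have hℓk : 2 * k + 2 ≤ ℓ := by nlinarith
  have hn : T.card + (k * k + k * k) < k * ℓ := by nlinarith
  set N := (Finset.univ.filter fun Z : Finset (Finset (Fin (k * ℓ))) =>
    IsKLPartition k ℓ Z ∧ (∃ p ∈ Z, T ⊆ p) ∧ ¬∃ p ∈ Z, ∃ q ∈ Y, t ≤ (p ∩ q).card).card
  have hgood : ((klContaining k ℓ T).filter fun Z => conflicts T Y Z = ∅).card ≤ N := by
    refine Finset.card_le_card fun Z hZ => ?_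
    obtain ⟨hZA, hZ0⟩ := Finset.mem_filter.1 hZ
    obtain ⟨-, hZ1, hZ2⟩ := Finset.mem_filter.1 hZA
    subst hTt
    exact Finset.mem_filter.2 ⟨Finset.mem_univ _, hZ1, hZ2,
      not_partially_intersect_of_conflicts_eq_empty ht hTY hZ0⟩
  have hexp : 2 * (k * (k - 1)) + k + k = 2 * k ^ 2 := by
    obtain ⟨j, rfl⟩ : ∃ j, k = j + 1 := ⟨k - 1, by omega⟩
    simp only [Nat.add_sub_cancel]
    ring
  have hconst : k * (k - 1) + 1 ≤ k ^ 2 := by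
    rw [Nat.mul_sub, mul_one, sq]
    have : k ≤ k * k := Nat.le_mul_self k
    omega
  have hmain : uKL k ℓ ≤ ℓ ^ (2 * k ^ 2) * N := calc
    uKL k ℓ ≤ (k * ℓ) ^ T.card * (klContaining k ℓ T).card :=
        uKL_le_card_klContaining (by omega) T (by omega)
    _ ≤ (k * ℓ) ^ k * (k ^ 2 * ((k * ℓ) ^ (2 * (k * (k - 1))) * N)) := by
        refine Nat.mul_le_mul (Nat.pow_le_pow_right (by omega) (by omega)) ?_
        refine (card_klContaining_le_mul_card_few_conflicts (by omega) (by omega) (by omega)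
          hY).trans (Nat.mul_le_mul hconst ?_)
        exact (card_few_conflicts_le hn hY _).trans (Nat.mul_le_mul_left _ hgood)
    _ = k ^ (2 * (k * (k - 1)) + k + 2) * ℓ ^ (2 * (k * (k - 1)) + k) * N := by ring
    _ ≤ ℓ ^ k * ℓ ^ (2 * (k * (k - 1)) + k) * N := by
        refine Nat.mul_le_mul_right _ (Nat.mul_le_mul_right _ ?_)
        calc k ^ (2 * (k * (k - 1)) + k + 2) ≤ k ^ (2 * k ^ 2 + 2) :=
              Nat.pow_le_pow_right (by omega) (by omega)
          _ ≤ ℓ := hℓ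
          _ ≤ ℓ ^ k := Nat.le_self_pow (by omega) ℓ
    _ = ℓ ^ (2 * k ^ 2) * N := by rw [← hexp]; ring
  have hℓpos : (0 : ℝ) < (ℓ : ℝ) ^ (2 * k ^ 2) := by
    have : (0 : ℝ) < ℓ := by exact_mod_cast (by omega : 0 < ℓ)
    positivity
  rw [inv_mul_le_iff₀ hℓpos]
  exact_mod_cast hmain
end

section
/- Let k ≥ 1 and ℓ ≥ 2 be integers. Every family 𝓕 of k-element sets with |𝓕| > (2^{10}·ℓ·log₂(kℓ))^k contains an ℓ-sunflower, i.e., ℓ distinct sets F₁,…,F_ℓ ∈ 𝓕 such that F_i ∩ F_j = F₁ ∩ F₂ ∩ … ∩ F_ℓ for all i ≠ j. -/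
open scoped Classical

/-- The expectation of `f W`, where `W` is the random subset of `X` that contains each element of
`X` independently with probability `q`. -/
noncomputable def bernoulliExp {α : Type*} [DecidableEq α] (X : Finset α) (q : ℝ)
    (f : Finset α → ℝ) : ℝ :=
  ∑ W ∈ X.powerset, q ^ W.card * (1 - q) ^ (X \ W).card * f W

section BernoulliExp

variable {α : Type*} [DecidableEq α]

lemma bernoulliExp_insert {X : Finset α} {x : α} (hx : x ∉ X) (q : ℝ) (f : Finset α → ℝ) :
    bernoulliExp (insert x X) q f =
      (1 - q) * bernoulliExp X q f + q * bernoulliExp X q (fun W => f (insert x W)) := by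
  unfold bernoulliExp
  rw [Finset.sum_powerset_insert hx, Finset.mul_sum, Finset.mul_sum]
  congr 1
  · refine Finset.sum_congr rfl fun W hW => ?_
    have hxW : x ∉ W := fun h => hx (Finset.mem_powerset.1 hW h)
    rw [Finset.insert_sdiff_of_notMem _ hxW,
      Finset.card_insert_of_notMem (fun h => hx (Finset.mem_sdiff.1 h).1)]
    ring
  · refine Finset.sum_congr rfl fun W hW => ?_
    have hxW : x ∉ W := fun h => hx (Finset.mem_powerset.1 hW h)
    have : insert x X \ insert x W = X \ W := by
      ext y
      by_cases hy : y = x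
      · subst hy; simp [hx]
      · simp [hy]
    rw [this, Finset.card_insert_of_notMem hxW]
    ring

lemma bernoulliExp_const (X : Finset α) (q c : ℝ) : bernoulliExp X q (fun _ => c) = c := by
  induction X using Finset.induction_on with
  | empty => simp [bernoulliExp]
  | insert x X hx ih => rw [bernoulliExp_insert hx, ih]; ring

lemma bernoulliExp_mono {X : Finset α} {q : ℝ} (h0 : 0 ≤ q) (h1 : q ≤ 1) {f g : Finset α → ℝ}
    (h : ∀ W ⊆ X, f W ≤ g W) : bernoulliExp X q f ≤ bernoulliExp X q g := by
  refine Finset.sum_le_sum fun W hW => ?_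
  have : 0 ≤ 1 - q := by linarith
  exact mul_le_mul_of_nonneg_left (h W (Finset.mem_powerset.1 hW)) (by positivity)

lemma bernoulliExp_add (X : Finset α) (q : ℝ) (f g : Finset α → ℝ) :
    bernoulliExp X q (fun W => f W + g W) = bernoulliExp X q f + bernoulliExp X q g := by
  simp [bernoulliExp, mul_add, Finset.sum_add_distrib]

lemma bernoulliExp_const_mul (X : Finset α) (q c : ℝ) (f : Finset α → ℝ) :
    bernoulliExp X q (fun W => c * f W) = c * bernoulliExp X q f := by
  simp only [bernoulliExp, Finset.mul_sum]
  exact Finset.sum_congr rfl fun W _ => by ring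

/-- The union of two independent Bernoulli subsets is a Bernoulli subset. -/
lemma bernoulliExp_union (X : Finset α) (p q : ℝ) (f : Finset α → ℝ) :
    bernoulliExp X p (fun W => bernoulliExp X q fun V => f (W ∪ V)) =
      bernoulliExp X (1 - (1 - p) * (1 - q)) f := by
  induction X using Finset.induction_on generalizing f with
  | empty => simp [bernoulliExp]
  | insert x X hx ih =>
    simp only [bernoulliExp_insert hx, bernoulliExp_add, bernoulliExp_const_mul, ih,
      Finset.insert_union, Finset.union_insert, Finset.insert_idem]
    have := ih fun W => f (insert x W)
    rw [this]
    ring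

/-- A colour class of a uniformly random colouring with `ℓ` colours is a Bernoulli subset with
parameter `1 / ℓ`. -/
lemma sum_colouring_eq (X : Finset α) {ℓ : ℕ} (hℓ : 0 < ℓ) (a : Fin ℓ) (f : Finset α → ℝ) :
    ∑ c : X → Fin ℓ, f ((Finset.univ.filter fun x => c x = a).map (Function.Embedding.subtype _)) =
      (ℓ : ℝ) ^ X.card * bernoulliExp X (1 / ℓ) f := by
  set w : (X → Fin ℓ) → Finset α :=
    fun c => (Finset.univ.filter fun x => c x = a).map (Function.Embedding.subtype _) with hw
  have hmem : ∀ c (x : X), (x : α) ∈ w c ↔ c x = a := by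
    intro c x
    simp [hw]
  have hsub : ∀ c, w c ⊆ X := by
    intro c x hx
    simp only [hw, Finset.mem_map] at hx
    obtain ⟨y, -, rfl⟩ := hx
    exact y.2
  have hmaps : ∀ c ∈ (Finset.univ : Finset (X → Fin ℓ)), w c ∈ X.powerset :=
    fun c _ => Finset.mem_powerset.2 (hsub c)
  change ∑ c : X → Fin ℓ, f (w c) = _
  rw [← Finset.sum_fiberwise_of_maps_to hmaps, bernoulliExp, Finset.mul_sum]
  refine Finset.sum_congr rfl fun W hW => ?_
  have hWX := Finset.mem_powerset.1 hW
  have hfib : (Finset.univ.filter fun c => w c = W) =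
      Fintype.piFinset fun x : X => if (x : α) ∈ W then {a} else Finset.univ.erase a := by
    ext c
    simp only [Finset.mem_filter, Finset.mem_univ, true_and, Fintype.mem_piFinset]
    constructor
    · rintro rfl x
      by_cases h : (x : α) ∈ w c
      · simpa [h] using (hmem c x).1 h
      · simpa [h] using fun h' => h ((hmem c x).2 h')
    · intro h
      ext x
      by_cases hx : x ∈ X
      · have hh := h ⟨x, hx⟩
        have h2 := hmem c ⟨x, hx⟩
        simp only at h2 hh
        rw [h2]
        by_cases hxW : x ∈ W
        · simpa [hxW] using hh
        · simpa [hxW] using hh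
      · exact ⟨fun h' => absurd (hsub c h') hx, fun h' => absurd (hWX h') hx⟩
  have hcard : (Finset.univ.filter fun c => w c = W).card = (ℓ - 1) ^ (X \ W).card := by
    rw [hfib, Fintype.card_piFinset]
    have : ∀ x : X, (if (x : α) ∈ W then ({a} : Finset (Fin ℓ)) else Finset.univ.erase a).card =
        (fun y : α => if y ∈ W then 1 else ℓ - 1) x := by
      intro x
      by_cases h : (x : α) ∈ W <;> simp [h]
    rw [Finset.prod_congr rfl fun x _ => this x,
      Finset.prod_coe_sort X (fun y : α => if y ∈ W then 1 else ℓ - 1), Finset.prod_ite]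
    simp [Finset.filter_notMem_eq_sdiff]
  rw [Finset.sum_congr rfl (g := fun _ => f W) (fun c hc => by rw [(Finset.mem_filter.1 hc).2]),
    Finset.sum_const, hcard, nsmul_eq_mul]
  have hX : X.card = W.card + (X \ W).card := by
    rw [Finset.card_sdiff_of_subset hWX]
    have := Finset.card_le_card hWX
    omega
  have hℓ' : (ℓ : ℝ) ≠ 0 := by positivity
  have h1 : (1 - 1 / (ℓ : ℝ)) = (ℓ - 1) / ℓ := by field_simp
  rw [hX, pow_add, h1, div_pow, div_pow]
  push_cast [Nat.cast_sub (show 1 ≤ ℓ from hℓ)]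
  rw [one_pow]
  field_simp

end BernoulliExp

/-- The sets of size more than a quarter of `Q` contained in `Q` have small total weight. -/
lemma sum_large_subsets_le {α : Type*} (Q : Finset α) (y : ℝ) (hy0 : 0 ≤ y) (hy : y ≤ 1 / 64) :
    ∑ T ∈ Q.powerset.filter (fun T => Q.card < 4 * T.card), (T.card : ℝ) * y ^ T.card ≤ 1 / 4 := by
  have hterm : ∀ T ∈ Q.powerset.filter (fun T => Q.card < 4 * T.card),
      (T.card : ℝ) * y ^ T.card ≤ (1 / 2) ^ Q.card * (1 / 4) := by
    intro T hT
    have hlt := (Finset.mem_filter.1 hT).2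
    have h1 : y ^ T.card ≤ (1 / 16) ^ T.card * (1 / 4) ^ T.card := by
      rw [← mul_pow]
      exact pow_le_pow_left₀ hy0 (by linarith) _
    have h2 : ((1 : ℝ) / 16) ^ T.card ≤ (1 / 2) ^ Q.card * (1 / 2) := by
      rw [show (1 : ℝ) / 16 = (1 / 2) ^ 4 by norm_num, ← pow_mul, ← pow_succ]
      exact pow_le_pow_of_le_one (by norm_num) (by norm_num) hlt
    have h3 : (T.card : ℝ) * (1 / 4) ^ T.card ≤ 1 / 2 := by
      have : (T.card : ℝ) ≤ 2 ^ T.card := by exact_mod_cast Nat.lt_two_pow_self.le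
      have h4 : (1 : ℝ) ≤ T.card := by exact_mod_cast (by omega : 1 ≤ T.card)
      calc (T.card : ℝ) * (1 / 4) ^ T.card ≤ 2 ^ T.card * (1 / 4) ^ T.card := by gcongr
        _ = (1 / 2) ^ T.card := by rw [← mul_pow]; norm_num
        _ ≤ (1 / 2) ^ 1 :=
          pow_le_pow_of_le_one (by norm_num) (by norm_num) (by exact_mod_cast h4)
        _ = 1 / 2 := by norm_num
    calc (T.card : ℝ) * y ^ T.card ≤ T.card * ((1 / 16) ^ T.card * (1 / 4) ^ T.card) := by gcongr
      _ = (1 / 16) ^ T.card * (T.card * (1 / 4) ^ T.card) := by ring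
      _ ≤ ((1 / 2) ^ Q.card * (1 / 2)) * (1 / 2) := by gcongr
      _ = (1 / 2) ^ Q.card * (1 / 4) := by ring
  refine (Finset.sum_le_sum hterm).trans ?_
  rw [Finset.sum_const, nsmul_eq_mul]
  have hc : ((Q.powerset.filter (fun T => Q.card < 4 * T.card)).card : ℝ) ≤ 2 ^ Q.card := by
    exact_mod_cast (Finset.card_filter_le _ _).trans (Finset.card_powerset Q).le
  calc _ ≤ (2 : ℝ) ^ Q.card * ((1 / 2) ^ Q.card * (1 / 4)) := by gcongr
    _ = 1 / 4 := by rw [← mul_assoc, ← mul_pow]; norm_num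

section Spread

variable {α ι : Type*} [DecidableEq α] [Fintype ι]

/-- Replace each `S i` by a smallest possible `S j \ W` contained in `S i`, with `S j` not larger
than `S i`. -/
lemma exists_reduction (S : ι → Finset α) (W : Finset α) (i : ι) :
    ∃ T ⊆ S i, Disjoint T W ∧ (∃ j, S j ⊆ W ∪ T ∧ T = S j \ W ∧ (S j).card ≤ (S i).card) ∧
      ∀ j, S j ⊆ W ∪ T → (S j).card ≤ (S i).card → T ⊆ S j := by
  obtain ⟨j, hj, hmin⟩ := Finset.exists_min_image
    (Finset.univ.filter fun j => S j ⊆ W ∪ S i ∧ (S j).card ≤ (S i).card)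
    (fun j => (S j \ W).card)
    ⟨i, by simp [Finset.subset_union_right]⟩
  simp only [Finset.mem_filter, Finset.mem_univ, true_and] at hj hmin
  have hTi : S j \ W ⊆ S i := by
    exact sdiff_le_iff.2 hj.1
  refine ⟨S j \ W, hTi, Finset.sdiff_disjoint, ⟨j, ?_, rfl, hj.2⟩, ?_⟩
  · rw [Finset.union_sdiff_self_eq_union]
    exact Finset.subset_union_right
  · intro j' hj' hc
    have h1 : S j' \ W ⊆ S j \ W := by
      intro x hx
      rw [Finset.mem_sdiff] at hx
      rcases Finset.mem_union.1 (hj' hx.1) with h | h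
      · exact absurd h hx.2
      · exact h
    have h2 := hmin j' ⟨hj'.trans (Finset.union_subset_union_right hTi), hc⟩
    rw [← Finset.eq_of_subset_of_card_le h1 h2]
    exact Finset.sdiff_subset

/-- For a spread family of nonempty sets, the reduced sets of `exists_reduction` are on average
at most half as large as the original ones. -/
lemma bernoulliExp_reduction_le (X : Finset α) (S : ι → Finset α) (hSX : ∀ i, S i ⊆ X)
    (hne : ∀ i, (S i).Nonempty) {r p : ℝ} (hp0 : 0 < p) (hp1 : p ≤ 1) (hr : 0 < r)
    (hpr : 64 ≤ p * r)
    (hspread : ∀ Z : Finset α,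
      r ^ Z.card * ((Finset.univ.filter fun i => Z ⊆ S i).card : ℝ) ≤ Fintype.card ι)
    (T : Finset α → ι → Finset α)
    (hTS : ∀ W i, T W i ⊆ S i) (hTW : ∀ W i, Disjoint (T W i) W)
    (hTj : ∀ W i, ∃ j, S j ⊆ W ∪ T W i ∧ (S j).card ≤ (S i).card)
    (hTmin : ∀ W i j, S j ⊆ W ∪ T W i → (S j).card ≤ (S i).card → T W i ⊆ S j) :
    bernoulliExp X p (fun W => ∑ i, ((T W i).card : ℝ)) ≤ (∑ i, ((S i).card : ℝ)) / 2 := by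
  have hcan : ∀ Z : Finset α, ∃ Q : Finset α, (∃ j, S j ⊆ Z) →
      (∃ j, Q = S j ∧ S j ⊆ Z) ∧ ∀ j, S j ⊆ Z → Q.card ≤ (S j).card := by
    intro Z
    by_cases h : ∃ j, S j ⊆ Z
    · obtain ⟨j, hj, hmin⟩ := Finset.exists_min_image
        (Finset.univ.filter fun j => S j ⊆ Z) (fun j => (S j).card)
        (by obtain ⟨j, hj⟩ := h; exact ⟨j, by simpa using hj⟩)
      simp only [Finset.mem_filter, Finset.mem_univ, true_and] at hj hmin
      exact ⟨S j, fun _ => ⟨⟨j, rfl, hj⟩, hmin⟩⟩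
    · exact ⟨∅, fun h' => absurd h' h⟩
  choose Q hQ using hcan
  set μ : Finset α → ℝ := fun W => p ^ W.card * (1 - p) ^ (X \ W).card with hμ
  have hq0 : 0 ≤ 1 - p := by linarith
  have hμ0 : ∀ W, 0 ≤ μ W := fun W => by simp only [hμ]; positivity
  set N : ℝ := (Fintype.card ι : ℝ) with hN
  have hN0 : 0 ≤ N := by simp [hN]
  have hlarge : ∑ x ∈ (X.powerset ×ˢ (Finset.univ : Finset ι)).filter
      (fun x => (S x.2).card < 4 * (T x.1 x.2).card), μ x.1 * ((T x.1 x.2).card : ℝ) ≤ N / 4 := by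
    set D : Finset ((_ : Finset α) × (_ : Finset α) × ι) :=
      X.powerset.sigma fun Z => ((Q Z).powerset.filter fun T => (Q Z).card < 4 * T.card).sigma
        fun T => Finset.univ.filter fun i => T ⊆ S i with hD
    set G : ((_ : Finset α) × (_ : Finset α) × ι) → ℝ :=
      fun z => μ z.1 * ((z.2.1.card : ℝ) * (1 / p) ^ z.2.1.card) with hG
    have hstep : ∑ x ∈ (X.powerset ×ˢ (Finset.univ : Finset ι)).filter
        (fun x => (S x.2).card < 4 * (T x.1 x.2).card), μ x.1 * ((T x.1 x.2).card : ℝ) ≤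
        ∑ z ∈ D, G z := by
      set e : Finset α × ι → ((_ : Finset α) × (_ : Finset α) × ι) :=
        fun x => ⟨x.1 ∪ T x.1 x.2, T x.1 x.2, x.2⟩ with he
      have hinj : Set.InjOn e ((X.powerset ×ˢ (Finset.univ : Finset ι)).filter
          (fun x => (S x.2).card < 4 * (T x.1 x.2).card) : Finset (Finset α × ι)) := by
        rintro ⟨W, i⟩ - ⟨W', i'⟩ - h
        simp only [he, Sigma.mk.injEq, heq_eq_eq] at h
        obtain ⟨h1, h2, h3⟩ := h
        subst h3
        have hW : ∀ W, (W ∪ T W i) \ T W i = W := fun W =>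
          Finset.union_sdiff_cancel_right (hTW W i).symm
        have : W = W' := by rw [← hW W, h1, h2, hW W']
        rw [this]
      calc _ ≤ ∑ x ∈ (X.powerset ×ˢ (Finset.univ : Finset ι)).filter
            (fun x => (S x.2).card < 4 * (T x.1 x.2).card), G (e x) := by
            refine Finset.sum_le_sum ?_
            rintro ⟨W, i⟩ hx
            simp only [Finset.mem_filter, Finset.mem_product, Finset.mem_powerset] at hx
            have hTX : T W i ⊆ X \ W := fun x hx' => Finset.mem_sdiff.2
              ⟨hSX i (hTS W i hx'), Finset.disjoint_left.1 (hTW W i) hx'⟩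
            have h1 : (W ∪ T W i).card = W.card + (T W i).card :=
              Finset.card_union_of_disjoint (hTW W i).symm
            have h2 : (X \ W).card = (X \ (W ∪ T W i)).card + (T W i).card := by
              rw [← Finset.card_sdiff_add_card_eq_card hTX]
              congr 2
              exact sdiff_sdiff_left
            have h3 : μ W ≤ μ (W ∪ T W i) * (1 / p) ^ (T W i).card := by
              simp only [hμ]
              rw [h1, h2, pow_add, pow_add]
              have h5 : (1 - p) ^ (T W i).card ≤ 1 := pow_le_one₀ hq0 (by linarith)
              have h6 : p ^ (T W i).card * (1 / p) ^ (T W i).card = 1 := by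
                rw [← mul_pow, mul_one_div_cancel hp0.ne', one_pow]
              calc p ^ W.card * ((1 - p) ^ (X \ (W ∪ T W i)).card * (1 - p) ^ (T W i).card)
                  ≤ p ^ W.card * ((1 - p) ^ (X \ (W ∪ T W i)).card * 1) := by gcongr
                _ = p ^ W.card * (1 - p) ^ (X \ (W ∪ T W i)).card *
                    (p ^ (T W i).card * (1 / p) ^ (T W i).card) := by rw [h6]; ring
                _ = _ := by ring
            calc μ W * ((T W i).card : ℝ)
                ≤ μ (W ∪ T W i) * (1 / p) ^ (T W i).card * ((T W i).card : ℝ) := by gcongr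
              _ = _ := by simp only [hG, he]; ring
        _ = ∑ z ∈ ((X.powerset ×ˢ (Finset.univ : Finset ι)).filter
            (fun x => (S x.2).card < 4 * (T x.1 x.2).card)).image e, G z :=
            (Finset.sum_image hinj).symm
        _ ≤ ∑ z ∈ D, G z := by
            refine Finset.sum_le_sum_of_subset_of_nonneg ?_ ?_
            · intro z hz
              obtain ⟨⟨W, i⟩, hx, rfl⟩ := Finset.mem_image.1 hz
              simp only [Finset.mem_filter, Finset.mem_product, Finset.mem_powerset,
                Finset.mem_univ, and_true] at hx
              obtain ⟨j, hj, hjc⟩ := hTj W i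
              obtain ⟨⟨j', hj', hj'Z⟩, hmin⟩ := hQ (W ∪ T W i) ⟨j, hj⟩
              have hc : (Q (W ∪ T W i)).card ≤ (S i).card := (hmin j hj).trans hjc
              have hTQ : T W i ⊆ Q (W ∪ T W i) := by
                rw [hj']
                exact hTmin W i j' hj'Z (hj' ▸ hc)
              simp only [hD, he, Finset.mem_sigma, Finset.mem_filter, Finset.mem_powerset,
                Finset.mem_univ, true_and]
              exact ⟨Finset.union_subset hx.1 ((hTS W i).trans (hSX i)),
                ⟨hTQ, lt_of_le_of_lt hc hx.2⟩, hTS W i⟩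
            · intro z _ _
              have := hμ0 z.1
              simp only [hG]
              positivity
    have hsum : ∑ z ∈ D, G z ≤ ∑ Z ∈ X.powerset, μ Z * (N / 4) := by
      rw [hD, Finset.sum_sigma]
      refine Finset.sum_le_sum fun Z _ => ?_
      rw [Finset.sum_sigma]
      simp only [hG, Finset.sum_const, nsmul_eq_mul]
      calc _ ≤ ∑ T ∈ (Q Z).powerset.filter (fun T => (Q Z).card < 4 * T.card),
            μ Z * N * ((T.card : ℝ) * (1 / (p * r)) ^ T.card) := by
            refine Finset.sum_le_sum fun T _ => ?_
            have h1 : ((Finset.univ.filter fun i => T ⊆ S i).card : ℝ) ≤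
                N * (1 / r) ^ T.card := by
              rw [one_div, inv_pow, ← div_eq_mul_inv, le_div_iff₀ (by positivity), mul_comm]
              exact hspread T
            have := hμ0 Z
            calc _ ≤ N * (1 / r) ^ T.card * (μ Z * ((T.card : ℝ) * (1 / p) ^ T.card)) := by
                  gcongr
              _ = μ Z * N * ((T.card : ℝ) * ((1 / p) ^ T.card * (1 / r) ^ T.card)) := by ring
              _ = _ := by rw [← mul_pow, one_div_mul_one_div]
        _ = μ Z * N * ∑ T ∈ (Q Z).powerset.filter (fun T => (Q Z).card < 4 * T.card),
            ((T.card : ℝ) * (1 / (p * r)) ^ T.card) := by rw [Finset.mul_sum]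
        _ ≤ μ Z * N * (1 / 4) := by
            have := hμ0 Z
            gcongr
            exact sum_large_subsets_le _ _ (by positivity)
              (one_div_le_one_div_of_le (by norm_num) hpr)
        _ = _ := by ring
    exact hstep.trans (hsum.trans (bernoulliExp_const X p (N / 4)).le)
  have hNS : N ≤ ∑ i, ((S i).card : ℝ) := by
    have : ∑ i : ι, (1 : ℝ) ≤ ∑ i, ((S i).card : ℝ) :=
      Finset.sum_le_sum fun i _ => by exact_mod_cast (hne i).card_pos
    simpa [hN] using this
  have hsplit : bernoulliExp X p (fun W => ∑ i, ((T W i).card : ℝ)) ≤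
      bernoulliExp X p (fun _ => ∑ i, ((S i).card : ℝ) / 4) +
      ∑ x ∈ (X.powerset ×ˢ (Finset.univ : Finset ι)).filter
      (fun x => (S x.2).card < 4 * (T x.1 x.2).card), μ x.1 * ((T x.1 x.2).card : ℝ) := by
    rw [Finset.sum_filter, Finset.sum_product]
    unfold bernoulliExp
    rw [← Finset.sum_add_distrib]
    refine Finset.sum_le_sum fun W _ => ?_
    rw [Finset.mul_sum, Finset.mul_sum, ← Finset.sum_add_distrib]
    refine Finset.sum_le_sum fun i _ => ?_
    have := hμ0 W
    change μ W * _ ≤ μ W * _ + _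
    simp only
    split_ifs with h
    · have : 0 ≤ μ W * ((S i).card / 4 : ℝ) := by positivity
      linarith
    · rw [add_zero]
      gcongr
      have : 4 * ((T W i).card : ℝ) ≤ (S i).card := by exact_mod_cast not_lt.1 h
      linarith
  rw [bernoulliExp_const, ← Finset.sum_div] at hsplit
  linarith

/-- A Bernoulli subset with parameter `1 - (1 - p) ^ m` is unlikely to contain no member of a
spread family. -/
lemma bernoulliExp_forall_not_subset_le [Nonempty ι] (X : Finset α) {r p : ℝ} (hp0 : 0 < p)
    (hp1 : p ≤ 1) (hr : 0 < r) (hpr : 64 ≤ p * r) (m : ℕ) (S : ι → Finset α)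
    (hSX : ∀ i, S i ⊆ X)
    (hspread : ∀ Z : Finset α,
      r ^ Z.card * ((Finset.univ.filter fun i => Z ⊆ S i).card : ℝ) ≤ Fintype.card ι) :
    bernoulliExp X (1 - (1 - p) ^ m) (fun W => if ∀ i, ¬ S i ⊆ W then 1 else 0) ≤
      (∑ i, ((S i).card : ℝ)) / (Fintype.card ι * 2 ^ m) := by
  have hN : (0 : ℝ) < Fintype.card ι := by exact_mod_cast Fintype.card_pos
  by_cases hne : ∀ i, (S i).Nonempty
  swap
  · have : (fun W => if ∀ i, ¬ S i ⊆ W then (1 : ℝ) else 0) = fun _ => 0 := by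
      funext W
      push Not at hne
      obtain ⟨i, hi⟩ := hne
      exact if_neg fun h => h i (by simp [hi])
    rw [this, bernoulliExp_const]
    positivity
  induction m generalizing S with
  | zero =>
    refine (bernoulliExp_mono (g := fun _ => 1) (by simp) (by simp)
      fun W _ => by split_ifs <;> norm_num).trans ?_
    rw [bernoulliExp_const, pow_zero, mul_one, le_div_iff₀ hN, one_mul]
    have : ∑ i : ι, (1 : ℝ) ≤ ∑ i, ((S i).card : ℝ) :=
      Finset.sum_le_sum fun i _ => by exact_mod_cast (hne i).card_pos
    simpa using this
  | succ m ih =>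
    choose T hTS hTW hTj hTmin using exists_reduction S
    have hq0 : 0 ≤ 1 - p := by linarith
    have hq1 : (1 - p) ^ m ≤ 1 := pow_le_one₀ hq0 (by linarith)
    have hqm : 0 ≤ (1 - p) ^ m := pow_nonneg hq0 m
    have key : ∀ W, bernoulliExp X (1 - (1 - p) ^ m)
        (fun V => if ∀ i, ¬ S i ⊆ W ∪ V then 1 else 0) ≤
        1 / (Fintype.card ι * 2 ^ m) * ∑ i, ((T W i).card : ℝ) := by
      intro W
      rw [one_div_mul_eq_div]
      calc _ ≤ bernoulliExp X (1 - (1 - p) ^ m)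
            (fun V => if ∀ i, ¬ T W i ⊆ V then 1 else 0) := by
            refine bernoulliExp_mono (by linarith) (by linarith) fun V _ => ?_
            split_ifs with h1 h2
            · exact le_rfl
            · exfalso
              push Not at h2
              obtain ⟨i, hi⟩ := h2
              obtain ⟨j, hj, -⟩ := hTj W i
              exact h1 j (hj.trans (Finset.union_subset_union_right hi))
            · norm_num
            · exact le_rfl
        _ ≤ _ := by
            by_cases hT : ∀ i, (T W i).Nonempty
            · refine ih (T W) (fun i => (hTS W i).trans (hSX i)) (fun Z => ?_) hT
              refine le_trans ?_ (hspread Z)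
              gcongr with i
              exact hTS W i
            · have : (fun V => if ∀ i, ¬ T W i ⊆ V then (1 : ℝ) else 0) = fun _ => 0 := by
                funext V
                push Not at hT
                obtain ⟨i, hi⟩ := hT
                exact if_neg fun h => h i (by simp [hi])
              rw [this, bernoulliExp_const]
              positivity
    have hpm : 1 - (1 - p) ^ (m + 1) = 1 - (1 - p) * (1 - (1 - (1 - p) ^ m)) := by ring
    rw [hpm, ← bernoulliExp_union]
    refine (bernoulliExp_mono hp0.le hp1 fun W _ => key W).trans ?_
    rw [bernoulliExp_const_mul]
    have := bernoulliExp_reduction_le X S hSX hne hp0 hp1 hr hpr hspread T hTS hTW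
      (fun W i => by obtain ⟨j, h1, -, h2⟩ := hTj W i; exact ⟨j, h1, h2⟩) hTmin
    calc _ ≤ 1 / (Fintype.card ι * 2 ^ m) * ((∑ i, ((S i).card : ℝ)) / 2) := by gcongr
      _ = _ := by rw [pow_succ]; field_simp

/-- A sufficiently spread family of sets of size at most `k` contains `ℓ` pairwise disjoint
members. -/
lemma exists_pairwise_disjoint_of_spread [Nonempty ι] {k ℓ m : ℕ} (hℓ : 2 ≤ ℓ) (hm : 0 < m)
    (hkm : k * ℓ < 2 ^ m) {r : ℝ} (hr : 64 * ℓ * m ≤ r) (S : ι → Finset α)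
    (hS : ∀ i, (S i).card ≤ k)
    (hspread : ∀ Z : Finset α,
      r ^ Z.card * ((Finset.univ.filter fun i => Z ⊆ S i).card : ℝ) ≤ Fintype.card ι) :
    ∃ t : Fin ℓ → ι, ∀ a b, a ≠ b → Disjoint (S (t a)) (S (t b)) := by
  have hℓ0 : (0 : ℝ) < ℓ := by positivity
  have hm0 : (0 : ℝ) < m := by positivity
  have hN : (0 : ℝ) < Fintype.card ι := by exact_mod_cast Fintype.card_pos
  have hℓ2 : (2 : ℝ) ≤ ℓ := by exact_mod_cast hℓ
  have hr0 : 0 < r := lt_of_lt_of_le (by positivity) hr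
  have hinv : 1 / (ℓ : ℝ) ≤ 1 / 2 := one_div_le_one_div_of_le (by norm_num) hℓ2
  have hinv0 : 0 < 1 / (ℓ : ℝ) := by positivity
  set X : Finset α := Finset.univ.biUnion S with hX
  have hSX : ∀ i, S i ⊆ X := fun i => Finset.subset_biUnion_of_mem S (Finset.mem_univ i)
  set q : ℝ := (1 - 1 / (ℓ : ℝ)) ^ ((m : ℝ)⁻¹) with hq
  have hq0 : 0 ≤ q := Real.rpow_nonneg (by linarith) _
  have hqm : q ^ m = 1 - 1 / (ℓ : ℝ) := Real.rpow_inv_natCast_pow (by linarith) hm.ne'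
  have hqle : q ≤ 1 - 1 / (ℓ * m) := by
    have hm1 : (1 : ℝ) ≤ m := by exact_mod_cast hm
    have h1 : 1 / ((ℓ : ℝ) * m) ≤ 1 / ℓ :=
      one_div_le_one_div_of_le hℓ0 (le_mul_of_one_le_right hℓ0.le hm1)
    have h2 := one_add_mul_le_pow (a := -(1 / ((ℓ : ℝ) * m))) (by linarith) m
    refine le_of_pow_le_pow_left₀ hm.ne' (by linarith) ?_
    rw [hqm]
    refine le_trans (le_of_eq ?_) (h2.trans (le_of_eq ?_))
    · field_simp
      ring
    · ring
  have hp : 1 / ((ℓ : ℝ) * m) ≤ 1 - q := by linarith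
  have hp0 : 0 < 1 - q := lt_of_lt_of_le (by positivity) hp
  have hpr : 64 ≤ (1 - q) * r := by
    calc (64 : ℝ) = 1 / (ℓ * m) * (64 * ℓ * m) := by field_simp
      _ ≤ (1 - q) * r := by gcongr
  have hbad := bernoulliExp_forall_not_subset_le X hp0 (by linarith) hr0 hpr m S hSX hspread
  rw [sub_sub_cancel, hqm, sub_sub_cancel] at hbad
  set bad : Finset α → ℝ := fun W => if ∀ i, ¬ S i ⊆ W then 1 else 0 with hbad_def
  have hbad_lt : bernoulliExp X (1 / ℓ) bad < 1 / ℓ := by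
    refine lt_of_le_of_lt hbad ?_
    have h1 : ∑ i, ((S i).card : ℝ) ≤ Fintype.card ι * k := by
      calc ∑ i, ((S i).card : ℝ) ≤ ∑ _i : ι, (k : ℝ) :=
            Finset.sum_le_sum fun i _ => by exact_mod_cast hS i
        _ = _ := by simp
    have h2 : (k : ℝ) * ℓ < 2 ^ m := by exact_mod_cast hkm
    rw [div_lt_div_iff₀ (by positivity) hℓ0]
    calc (∑ i, ((S i).card : ℝ)) * ℓ ≤ Fintype.card ι * k * ℓ := by gcongr
      _ = Fintype.card ι * (k * ℓ) := by ring
      _ < Fintype.card ι * 2 ^ m := by gcongr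
      _ = _ := by ring
  set w : (X → Fin ℓ) → Fin ℓ → Finset α := fun c a =>
    (Finset.univ.filter fun x => c x = a).map (Function.Embedding.subtype _) with hw
  have hsum : ∑ c : X → Fin ℓ, ∑ a, bad (w c a) < ∑ _c : X → Fin ℓ, 1 := by
    rw [Finset.sum_comm]
    simp only [hw, sum_colouring_eq X (by omega : 0 < ℓ)]
    simp only [Finset.sum_const, Finset.card_univ, Fintype.card_fun, Fintype.card_fin,
      Fintype.card_coe, nsmul_eq_mul, mul_one]
    push_cast
    calc (ℓ : ℝ) * (ℓ ^ X.card * bernoulliExp X (1 / ℓ) bad)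
        < ℓ * (ℓ ^ X.card * (1 / ℓ)) := by gcongr
      _ = ℓ ^ X.card := by field_simp
  obtain ⟨c, -, hc⟩ := Finset.exists_lt_of_sum_lt hsum
  have hgood : ∀ a, ∃ i, S i ⊆ w c a := by
    intro a
    by_contra! h
    have h1 : bad (w c a) = 1 := if_pos h
    have h2 : bad (w c a) ≤ ∑ a, bad (w c a) :=
      Finset.single_le_sum (f := fun a => bad (w c a))
        (fun b _ => by simp only [hbad_def]; split_ifs <;> norm_num) (Finset.mem_univ a)
    linarith
  choose t ht using hgood
  refine ⟨t, fun a b hab => Finset.disjoint_left.2 fun x hxa hxb => hab ?_⟩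
  have h1 := ht a hxa
  have h2 := ht b hxb
  simp only [hw, Finset.mem_map, Finset.mem_filter, Finset.mem_univ, true_and] at h1 h2
  obtain ⟨y, hy, hyx⟩ := h1
  obtain ⟨z, hz, hzx⟩ := h2
  have : y = z := Subtype.ext (hyx.trans hzx.symm)
  rw [← hy, ← hz, this]

end Spread

/-- A uniform family with many members has a large link that is spread. -/
lemma exists_spread_link {α : Type*} [DecidableEq α] {k : ℕ} {R : ℝ} (hR : 0 < R)
    (𝓕 : Finset (Finset α)) (hunif : ∀ A ∈ 𝓕, A.card = k) (hcard : R ^ k < (𝓕.card : ℝ)) :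
    ∃ Z : Finset α, Z.card < k ∧ (𝓕.filter (Z ⊆ ·)).Nonempty ∧
      ∀ Y, Disjoint Y Z → R ^ Y.card * ((𝓕.filter (Z ∪ Y ⊆ ·)).card : ℝ) ≤
        (𝓕.filter (Z ⊆ ·)).card := by
  obtain ⟨Z, -, hmax⟩ := Finset.exists_max_image (𝓕.sup id).powerset
    (fun Z => R ^ Z.card * ((𝓕.filter (Z ⊆ ·)).card : ℝ)) ⟨∅, by simp⟩
  have hF : (𝓕.card : ℝ) ≤ R ^ Z.card * ((𝓕.filter (Z ⊆ ·)).card : ℝ) := by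
    simpa using hmax ∅ (by simp)
  have hpos : 0 < (𝓕.card : ℝ) := lt_trans (by positivity) hcard
  have hne : (𝓕.filter (Z ⊆ ·)).Nonempty := by
    rw [Finset.nonempty_iff_ne_empty]
    intro h
    rw [h] at hF
    simp at hF
    simp [hF] at hpos
  refine ⟨Z, ?_, hne, fun Y hY => ?_⟩
  · by_contra! hk
    have hsub : 𝓕.filter (Z ⊆ ·) ⊆ {Z} := by
      intro A hA
      rw [Finset.mem_filter] at hA
      rw [Finset.mem_singleton]
      exact (Finset.eq_of_subset_of_card_le hA.2 (by rw [hunif A hA.1]; exact hk)).symm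
    obtain ⟨A, hA⟩ := hne
    have hAZ := Finset.mem_singleton.1 (hsub hA)
    have hZ : Z.card = k := hAZ ▸ hunif A (Finset.mem_filter.1 hA).1
    have h1 : ((𝓕.filter (Z ⊆ ·)).card : ℝ) ≤ 1 := by
      exact_mod_cast Finset.card_le_card hsub
    rw [hZ] at hF
    have : R ^ k * ((𝓕.filter (Z ⊆ ·)).card : ℝ) ≤ R ^ k * 1 := by gcongr
    linarith
  · by_cases h : Z ∪ Y ⊆ 𝓕.sup id
    · have := hmax (Z ∪ Y) (Finset.mem_powerset.2 h)
      rw [Finset.card_union_of_disjoint hY.symm, pow_add, mul_assoc] at this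
      exact le_of_mul_le_mul_left this (by positivity)
    · have : 𝓕.filter (Z ∪ Y ⊆ ·) = ∅ :=
        Finset.filter_false_of_mem fun A hA hZ => h (hZ.trans (Finset.le_sup (f := id) hA))
      rw [this]
      simp

theorem stmt16 {α : Type*} [DecidableEq α] (k ℓ : ℕ) (hk : 1 ≤ k) (hℓ : 2 ≤ ℓ)
    (𝓕 : Finset (Finset α)) (hunif : ∀ A ∈ 𝓕, A.card = k)
    (hcard : ((2 ^ 10 : ℝ) * ℓ * Real.logb 2 (k * ℓ)) ^ k < (𝓕.card : ℝ)) :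
    ∃ 𝓢 ⊆ 𝓕, ∃ h𝓢 : 𝓢.Nonempty, 𝓢.card = ℓ ∧
      -- `𝓢` is an `ℓ`-sunflower: pairwise intersections all equal the core `∩_{A ∈ 𝓢} A`
      ∀ A ∈ 𝓢, ∀ B ∈ 𝓢, A ≠ B → A ∩ B = 𝓢.inf' h𝓢 id := by
  set L : ℝ := Real.logb 2 (k * ℓ) with hL
  have hkl : 2 ≤ k * ℓ := by nlinarith
  have hL1 : 1 ≤ L := by
    rw [hL, Real.le_logb_iff_rpow_le (by norm_num) (by positivity)]
    rw [Real.rpow_one]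
    exact_mod_cast hkl
  have hℓ0 : (0 : ℝ) < ℓ := by positivity
  set m : ℕ := Nat.log 2 (k * ℓ) + 1 with hm
  have hmL : (m : ℝ) ≤ 2 * L := by
    have : (Nat.log 2 (k * ℓ) : ℝ) ≤ L := by
      have := Real.natLog_le_logb (k * ℓ) 2
      push_cast at this
      exact this
    rw [hm]
    push_cast
    linarith
  have hR : 64 * ℓ * (m : ℝ) ≤ 2 ^ 10 * ℓ * L := by
    calc 64 * ℓ * (m : ℝ) ≤ 64 * ℓ * (2 * L) := by gcongr
      _ ≤ 2 ^ 10 * ℓ * L := by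
        have : 0 ≤ ℓ * L := by positivity
        linarith
  obtain ⟨Z, hZk, hne, hspread⟩ := exists_spread_link (by positivity) 𝓕 hunif hcard
  have : Nonempty ↥(𝓕.filter (Z ⊆ ·)) := hne.to_subtype
  have hmemF : ∀ A : ↥(𝓕.filter (Z ⊆ ·)), (A : Finset α) ∈ 𝓕 ∧ Z ⊆ A :=
    fun A => Finset.mem_filter.1 A.2
  obtain ⟨t, ht⟩ := exists_pairwise_disjoint_of_spread (k := k) hℓ (Nat.succ_pos _)
    (Nat.lt_pow_succ_log_self (by norm_num) _) hR
    (fun A : ↥(𝓕.filter (Z ⊆ ·)) => (A : Finset α) \ Z)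
    (fun A => (Finset.card_le_card Finset.sdiff_subset).trans (hunif A (hmemF A).1).le)
    (by
      intro Y
      rw [Fintype.card_coe]
      by_cases hY : Disjoint Y Z
      · refine le_trans ?_ (hspread Y hY)
        gcongr
        refine Finset.card_le_card_of_injOn Subtype.val ?_ Subtype.val_injective.injOn
        intro A hA
        simp only [Finset.coe_filter, Finset.mem_univ, true_and, Set.mem_ofPred_eq] at hA ⊢
        exact ⟨(hmemF A).1, Finset.union_subset (hmemF A).2 (hA.trans Finset.sdiff_subset)⟩
      · have : (Finset.univ.filter fun A : ↥(𝓕.filter (Z ⊆ ·)) => Y ⊆ (A : Finset α) \ Z) = ∅ :=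
          Finset.filter_false_of_mem fun A _ h =>
            hY (Finset.disjoint_of_subset_left h Finset.sdiff_disjoint)
        rw [this]
        simp)
  have hinter : ∀ a b, a ≠ b → (t a : Finset α) ∩ t b = Z := by
    intro a b hab
    refine Finset.Subset.antisymm (fun x hx => ?_)
      (Finset.subset_inter (hmemF (t a)).2 (hmemF (t b)).2)
    by_contra hxZ
    rw [Finset.mem_inter] at hx
    exact Finset.disjoint_left.1 (ht a b hab) (Finset.mem_sdiff.2 ⟨hx.1, hxZ⟩)
      (Finset.mem_sdiff.2 ⟨hx.2, hxZ⟩)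
  have hinj : Function.Injective fun a => (t a : Finset α) := by
    intro a b hab
    by_contra hne
    have h1 := hinter a b hne
    simp only at hab
    rw [← hab, Finset.inter_self] at h1
    have h2 := hunif _ (hmemF (t a)).1
    rw [h1] at h2
    omega
  have h𝓢 : (Finset.univ.image fun a => (t a : Finset α)).Nonempty :=
    ⟨t ⟨0, by omega⟩, Finset.mem_image_of_mem _ (Finset.mem_univ _)⟩
  refine ⟨Finset.univ.image fun a => (t a : Finset α), ?_, h𝓢, ?_, ?_⟩
  · intro A hA
    obtain ⟨a, -, rfl⟩ := Finset.mem_image.1 hA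
    exact (hmemF (t a)).1
  · rw [Finset.card_image_of_injective _ hinj, Finset.card_univ, Fintype.card_fin]
  · intro A hA B hB hAB
    refine le_antisymm ?_ (le_inf (Finset.inf'_le id hA) (Finset.inf'_le id hB))
    obtain ⟨a, -, rfl⟩ := Finset.mem_image.1 hA
    obtain ⟨b, -, rfl⟩ := Finset.mem_image.1 hB
    rw [hinter a b fun h => hAB (by rw [h])]
    refine Finset.le_inf' _ _ fun C hC => ?_
    obtain ⟨c, -, rfl⟩ := Finset.mem_image.1 hC
    exact (hmemF (t c)).2
end

section
/- Let k ≥ 2 and t ≥ 2 be integers and let G be a finite simple graph in which every connected component has at most k vertices. For such a graph define m(G) = Σ_C (|C| − 1), the sum over all connected components C of G containing at least one edge. (i) If G has exactly C(t,2) = t(t−1)/2 edges, then m(G) ≥ t − 1, and m(G) = t − 1 if and only if the edges of G span a single connected component on exactly t vertices (which is then a complete graph on t vertices). (ii) If G has exactly C(t,2) + s edges for an integer s ≥ 0, then m(G) ≥ t − 1 + s/k. -/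
open scoped Classical

namespace SimpleGraph

variable {V : Type*} [Fintype V] (G : SimpleGraph V)

theorem natCard_supp_eq_card_filter (c : G.ConnectedComponent) :
    Nat.card c.supp = (Finset.univ.filter fun v => G.connectedComponentMk v = c).card := by
  rw [Nat.card_eq_fintype_card, Fintype.card_subtype]
  simp

variable {G} in
theorem ConnectedComponent.natCard_supp_pos (c : G.ConnectedComponent) :
    0 < Nat.card c.supp := by
  have := c.nonempty_supp.to_subtype
  exact Nat.card_pos

theorem exists_adj_of_one_lt_natCard_supp {c : G.ConnectedComponent}
    (hc : 1 < Nat.card c.supp) : ∃ v w, G.Adj v w ∧ G.connectedComponentMk v = c := by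
  rw [natCard_supp_eq_card_filter, Finset.one_lt_card] at hc
  obtain ⟨v, hv, w, hw, hvw⟩ := hc
  simp only [Finset.mem_filter, Finset.mem_univ, true_and] at hv hw
  obtain ⟨p⟩ := ConnectedComponent.exact (hv.trans hw.symm)
  cases p with
  | nil => exact absurd rfl hvw
  | cons h _ => exact ⟨v, _, h, hv⟩

theorem neighborFinset_subset_component_erase (v : V) :
    G.neighborFinset v ⊆ (Finset.univ.filter fun w =>
      G.connectedComponentMk w = G.connectedComponentMk v).erase v := by
  intro w hw
  rw [mem_neighborFinset] at hw
  simp only [Finset.mem_erase, Finset.mem_filter, Finset.mem_univ, true_and]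
  exact ⟨hw.ne', (ConnectedComponent.sound hw.reachable).symm⟩

theorem card_component_erase (v : V) :
    ((Finset.univ.filter fun w =>
      G.connectedComponentMk w = G.connectedComponentMk v).erase v).card =
      Nat.card (G.connectedComponentMk v).supp - 1 := by
  rw [Finset.card_erase_of_mem (by simp), natCard_supp_eq_card_filter]

theorem degree_le_natCard_supp_sub_one (v : V) :
    G.degree v ≤ Nat.card (G.connectedComponentMk v).supp - 1 := by
  rw [← card_component_erase, ← card_neighborFinset_eq_degree]
  exact Finset.card_le_card (G.neighborFinset_subset_component_erase v)

theorem adj_of_degree_eq_natCard_supp_sub_one {v w : V}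
    (hv : G.degree v = Nat.card (G.connectedComponentMk v).supp - 1)
    (hw : G.connectedComponentMk w = G.connectedComponentMk v) (hvw : v ≠ w) : G.Adj v w := by
  rw [← card_component_erase, ← card_neighborFinset_eq_degree] at hv
  have h := Finset.eq_of_subset_of_card_le (G.neighborFinset_subset_component_erase v) hv.ge
  rw [← mem_neighborFinset, h, Finset.mem_erase, Finset.mem_filter]
  exact ⟨hvw.symm, Finset.mem_univ w, hw⟩

theorem sum_component_eq (f : G.ConnectedComponent → ℕ) :
    ∑ v, f (G.connectedComponentMk v) = ∑ c : G.ConnectedComponent, Nat.card c.supp * f c := by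
  rw [← Finset.sum_fiberwise (s := Finset.univ) (g := G.connectedComponentMk)]
  refine Finset.sum_congr rfl fun c _ => ?_
  rw [natCard_supp_eq_card_filter, ← smul_eq_mul, ← Finset.sum_const]
  refine Finset.sum_congr rfl fun v hv => ?_
  rw [(Finset.mem_filter.mp hv).2]

theorem sum_degree_eq_two_mul_natCard_edgeSet :
    ∑ v, G.degree v = 2 * Nat.card G.edgeSet := by
  rw [sum_degrees_eq_twice_card_edges, Nat.card_eq_fintype_card, edgeFinset_card]

theorem two_mul_natCard_edgeSet_le :
    2 * Nat.card G.edgeSet ≤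
      ∑ c : G.ConnectedComponent, Nat.card c.supp * (Nat.card c.supp - 1) := by
  rw [← sum_degree_eq_two_mul_natCard_edgeSet,
    ← G.sum_component_eq fun c => Nat.card c.supp - 1]
  exact Finset.sum_le_sum fun v _ => G.degree_le_natCard_supp_sub_one v

theorem finsum_nontrivial_component_eq :
    ∑ᶠ c ∈ {c : G.ConnectedComponent | ∃ v w, G.Adj v w ∧ G.connectedComponentMk v = c},
      (Nat.card c.supp - 1) = ∑ c : G.ConnectedComponent, (Nat.card c.supp - 1) := by
  rw [← finsum_eq_sum_of_fintype]
  refine finsum_congr fun c => ?_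
  rw [finsum_eq_if]
  split_ifs with h
  · rfl
  · by_contra h0
    exact h (G.exists_adj_of_one_lt_natCard_supp (by omega))

theorem one_lt_natCard_supp_of_adj {v w : V} (h : G.Adj v w) :
    1 < Nat.card (G.connectedComponentMk v).supp := by
  rw [natCard_supp_eq_card_filter, Finset.one_lt_card]
  exact ⟨v, by simp, w, by simpa using (ConnectedComponent.sound h.reachable).symm, h.ne⟩

theorem two_mul_natCard_edgeSet_le_mul_sum {k : ℕ}
    (hk : ∀ c : G.ConnectedComponent, Nat.card c.supp ≤ k) :
    2 * Nat.card G.edgeSet ≤ k * ∑ c : G.ConnectedComponent, (Nat.card c.supp - 1) := by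
  rw [Finset.mul_sum]
  exact G.two_mul_natCard_edgeSet_le.trans
    (Finset.sum_le_sum fun c _ => Nat.mul_le_mul_right _ (hk c))

theorem natCard_supp_le_sum_add_one (c : G.ConnectedComponent) :
    Nat.card c.supp ≤ ∑ d : G.ConnectedComponent, (Nat.card d.supp - 1) + 1 := by
  have := Finset.single_le_sum (f := fun d : G.ConnectedComponent => Nat.card d.supp - 1)
    (fun _ _ => Nat.zero_le _) (Finset.mem_univ c)
  omega

/-- If the edge bound is attained, then some component carries the whole rank, and every vertex is
adjacent to all other vertices of its component. -/
theorem exists_complete_component {m : ℕ} (hm : 0 < m)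
    (hsum : ∑ c : G.ConnectedComponent, (Nat.card c.supp - 1) = m)
    (hE : 2 * Nat.card G.edgeSet = (m + 1) * m) :
    ∃ c : G.ConnectedComponent,
      (∀ v w, G.Adj v w → G.connectedComponentMk v = c) ∧ Nat.card c.supp = m + 1 ∧
      ∀ v w, G.connectedComponentMk v = c → G.connectedComponentMk w = c → v ≠ w → G.Adj v w := by
  have hle : ∀ c : G.ConnectedComponent, Nat.card c.supp ≤ m + 1 := fun c =>
    hsum ▸ G.natCard_supp_le_sum_add_one c
  have hex : ∃ c : G.ConnectedComponent, Nat.card c.supp = m + 1 := by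
    by_contra! h
    have := G.two_mul_natCard_edgeSet_le_mul_sum (k := m) fun c => by
      have := hle c; have := h c; omega
    rw [hsum, hE] at this
    nlinarith
  obtain ⟨c, hc⟩ := hex
  have hdeg : ∀ v, G.degree v = Nat.card (G.connectedComponentMk v).supp - 1 := by
    have h := (Finset.sum_eq_sum_iff_of_le
      fun v (_ : v ∈ Finset.univ) => G.degree_le_natCard_supp_sub_one v).mp ?_
    · exact fun v => h v (Finset.mem_univ v)
    refine le_antisymm (Finset.sum_le_sum fun v _ => G.degree_le_natCard_supp_sub_one v) ?_
    rw [sum_degree_eq_two_mul_natCard_edgeSet, hE,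
      G.sum_component_eq fun c => Nat.card c.supp - 1, ← hsum, Finset.mul_sum, hsum]
    exact Finset.sum_le_sum fun c _ => Nat.mul_le_mul_right _ (hle c)
  refine ⟨c, fun v w h => ?_, hc, fun v w hv hw hvw =>
    G.adj_of_degree_eq_natCard_supp_sub_one (hdeg v) (hw.trans hv.symm) hvw⟩
  by_contra hne
  have hlt := G.one_lt_natCard_supp_of_adj h
  have hpair := Finset.sum_le_sum_of_subset
    (f := fun d : G.ConnectedComponent => Nat.card d.supp - 1)
    (Finset.subset_univ {G.connectedComponentMk v, c})
  rw [Finset.sum_pair hne, hsum] at hpair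
  omega

theorem sum_eq_of_adj_mem_component {c : G.ConnectedComponent}
    (hc : ∀ v w, G.Adj v w → G.connectedComponentMk v = c) :
    ∑ d : G.ConnectedComponent, (Nat.card d.supp - 1) = Nat.card c.supp - 1 := by
  refine Finset.sum_eq_single c (fun d _ hd => ?_) (by simp)
  by_contra h
  obtain ⟨v, w, hvw, rfl⟩ := G.exists_adj_of_one_lt_natCard_supp (c := d) (by omega)
  exact hd (hc v w hvw)

end SimpleGraph

theorem stmt17 {V : Type*} [Fintype V] (G : SimpleGraph V) (k t : ℕ)
    (hk : 2 ≤ k) (ht : 2 ≤ t)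
    -- every connected component has at most `k` vertices
    (hcomp : ∀ c : G.ConnectedComponent, Nat.card c.supp ≤ k)
    -- `m = m(G) = Σ_C (|C| − 1)`, summed over components containing at least one edge
    (m : ℕ)
    (hm : m = ∑ᶠ c ∈ {c : G.ConnectedComponent |
        ∃ v w, G.Adj v w ∧ G.connectedComponentMk v = c},
      (Nat.card c.supp - 1)) :
    -- (i)
    (Nat.card G.edgeSet = t.choose 2 →
      t - 1 ≤ m ∧
        (m = t - 1 ↔
          ∃ c : G.ConnectedComponent,
            (∀ v w, G.Adj v w → G.connectedComponentMk v = c) ∧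
            Nat.card c.supp = t ∧
            ∀ v w, G.connectedComponentMk v = c → G.connectedComponentMk w = c →
              v ≠ w → G.Adj v w)) ∧
    -- (ii)
    (∀ s : ℕ, Nat.card G.edgeSet = t.choose 2 + s →
      (t : ℝ) - 1 + (s : ℝ) / (k : ℝ) ≤ (m : ℝ)) := by
  rw [G.finsum_nontrivial_component_eq] at hm
  have htwo : 2 * t.choose 2 = t * (t - 1) := by
    rw [Nat.choose_two_right, Nat.mul_div_cancel' (Nat.even_mul_pred_self t).two_dvd]
  have hEk := hm ▸ G.two_mul_natCard_edgeSet_le_mul_sum hcomp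
  have hEm := hm ▸ G.two_mul_natCard_edgeSet_le_mul_sum G.natCard_supp_le_sum_add_one
  obtain ⟨u, rfl⟩ : ∃ u, t = u + 1 := ⟨t - 1, by omega⟩
  simp only [Nat.add_sub_cancel] at htwo ⊢
  have hlow : (u + 1).choose 2 ≤ Nat.card G.edgeSet → u ≤ m := fun h => by
    by_contra! hlt
    nlinarith
  refine ⟨fun hE => ⟨hlow hE.ge, fun hmu => ?_, ?_⟩, fun s hE => ?_⟩
  · subst hmu
    exact G.exists_complete_component (by omega) hm.symm (by rw [hE, htwo])
  · rintro ⟨c, hadj, hcard, -⟩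
    rw [hm, G.sum_eq_of_adj_mem_component hadj, hcard, Nat.add_sub_cancel]
  · obtain ⟨d, rfl⟩ := Nat.exists_eq_add_of_le (hlow (hE ▸ Nat.le_add_right _ _))
    have hs : s ≤ d * k := by
      rw [hE, mul_add, htwo] at hEk hEm
      by_cases hmk : u + d + 1 ≤ k
      · nlinarith
      · zify at *
        have hint : 0 ≤ ((k : ℤ) - (u + 1)) * (k - (u + 1) + 1) := by
          rcases le_or_gt 0 ((k : ℤ) - (u + 1)) with h | h
          · positivity
          · exact mul_nonneg_of_nonpos_of_nonpos h.le (by omega)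
        nlinarith
    have hk0 : (0 : ℝ) < k := by exact_mod_cast (by omega : 0 < k)
    have : (s : ℝ) / k ≤ d := by
      rw [div_le_iff₀ hk0]
      exact_mod_cast hs
    push_cast
    linarith
end

section
/- Let k ≥ 2, ℓ ≥ 1, a ≥ 1 be integers with a ≤ ℓ, and let x₁,…,x_a be integers with 2 ≤ x_i ≤ k for all i. Put m = Σ_{i=1}^a (x_i − 1) and assume 3m ≤ kℓ. Then (kℓ − m − a)! / ((ℓ − a)! · (k!)^{ℓ−a} · ∏_{i=1}^a (k − x_i)!) ≤ (9/ℓ)^m · (kℓ)! / (ℓ! · (k!)^ℓ), as an inequality of rational numbers. -/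
open scoped Classical

lemma pow_le_three_pow_mul_descFactorial (n s : ℕ) (h : 3 * s ≤ 2 * n) :
    n ^ s ≤ 3 ^ s * n.descFactorial s :=
  calc n ^ s ≤ (3 * (n + 1 - s)) ^ s := Nat.pow_le_pow_left (by lia) s
    _ = 3 ^ s * (n + 1 - s) ^ s := mul_pow _ _ _
    _ ≤ 3 ^ s * n.descFactorial s := Nat.mul_le_mul_left _ (Nat.pow_sub_le_descFactorial n s)

lemma descFactorial_mul_prod_descFactorial_le {k ℓ a m : ℕ} (x : Fin a → ℕ)
    (hsum : ∑ i, x i = m + a) (ham : a ≤ m) (h3m : 3 * m ≤ k * ℓ) :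
    ℓ ^ m * (ℓ.descFactorial a * ∏ i, k.descFactorial (x i)) ≤
      9 ^ m * (k * ℓ).descFactorial (m + a) :=
  calc ℓ ^ m * (ℓ.descFactorial a * ∏ i, k.descFactorial (x i))
      ≤ ℓ ^ m * (ℓ ^ a * ∏ i, k ^ x i) := by
        gcongr
        · exact Nat.descFactorial_le_pow _ _
        · exact Nat.descFactorial_le_pow _ _
    _ = (k * ℓ) ^ (m + a) := by
        rw [Finset.prod_pow_eq_pow_sum, hsum]
        ring
    _ ≤ 3 ^ (m + a) * (k * ℓ).descFactorial (m + a) :=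
        pow_le_three_pow_mul_descFactorial _ _ (by lia)
    _ ≤ 3 ^ (2 * m) * (k * ℓ).descFactorial (m + a) := by
        gcongr
        · norm_num
        · lia
    _ = 9 ^ m * (k * ℓ).descFactorial (m + a) := by
        rw [pow_mul]
        norm_num

theorem stmt18 (k ℓ a : ℕ) (hk : 2 ≤ k) (hℓ : 1 ≤ ℓ) (ha : 1 ≤ a) (haℓ : a ≤ ℓ)
    (x : Fin a → ℕ) (hx : ∀ i, 2 ≤ x i ∧ x i ≤ k)
    (m : ℕ) (hm : m = ∑ i, (x i - 1)) (h3m : 3 * m ≤ k * ℓ) :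
    ((k * ℓ - m - a).factorial : ℚ) /
        (((ℓ - a).factorial : ℚ) * (k.factorial : ℚ) ^ (ℓ - a) *
          ∏ i, ((k - x i).factorial : ℚ)) ≤
      (9 / (ℓ : ℚ)) ^ m * ((k * ℓ).factorial : ℚ) /
        ((ℓ.factorial : ℚ) * (k.factorial : ℚ) ^ ℓ) := by
  have hsum : ∑ i, x i = m + a := by
    have h : ∑ i, x i = ∑ i, ((x i - 1) + 1) :=
      Finset.sum_congr rfl fun i _ => by have := hx i; lia
    rw [h, Finset.sum_add_distrib, ← hm]
    simp
  have ham : a ≤ m := by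
    have h : ∑ _i : Fin a, 1 ≤ ∑ i, (x i - 1) :=
      Finset.sum_le_sum fun i _ => by have := hx i; lia
    simpa [← hm] using h
  have hn : m + a ≤ k * ℓ := by lia
  have key : (ℓ : ℚ) ^ m * (ℓ.descFactorial a * ∏ i, (k.descFactorial (x i) : ℚ)) ≤
      9 ^ m * (k * ℓ).descFactorial (m + a) := by
    exact_mod_cast descFactorial_mul_prod_descFactorial_le x hsum ham h3m
  have hℓ0 : (0 : ℚ) < ℓ := by exact_mod_cast hℓ
  have hnfac : ((k * ℓ).factorial : ℚ) =
      (k * ℓ - m - a).factorial * (k * ℓ).descFactorial (m + a) := by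
    rw [Nat.sub_sub]
    exact_mod_cast (Nat.factorial_mul_descFactorial hn).symm
  have hℓfac : (ℓ.factorial : ℚ) = (ℓ - a).factorial * ℓ.descFactorial a := by
    exact_mod_cast (Nat.factorial_mul_descFactorial haℓ).symm
  have hkfac : (k.factorial : ℚ) ^ a =
      (∏ i, ((k - x i).factorial : ℚ)) * ∏ i, (k.descFactorial (x i) : ℚ) := by
    rw [← Finset.prod_mul_distrib]
    have h : ∀ i, ((k - x i).factorial : ℚ) * k.descFactorial (x i) = k.factorial := fun i => by
      exact_mod_cast Nat.factorial_mul_descFactorial (hx i).2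
    simp [h]
  have hkpow : (k.factorial : ℚ) ^ ℓ = k.factorial ^ (ℓ - a) * k.factorial ^ a := by
    rw [← pow_add, Nat.sub_add_cancel haℓ]
  have hprod : 0 < ∏ i, ((k - x i).factorial : ℚ) :=
    Finset.prod_pos fun i _ => by positivity
  rw [div_le_div_iff₀ (by positivity) (by positivity), hkpow, hkfac, hnfac, hℓfac, div_pow,
    div_mul_eq_mul_div, div_mul_eq_mul_div, le_div_iff₀ (by positivity)]
  have hmul := mul_le_mul_of_nonneg_left key
    (a := ((k * ℓ - m - a).factorial : ℚ) * ((ℓ - a).factorial * k.factorial ^ (ℓ - a) *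
      ∏ i, ((k - x i).factorial : ℚ))) (by positivity)
  linarith
end
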